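/- arXiv:1302.0812 — 4 statements merged into one kernel-verified Lean document; each statement's English description precedes it below -/
import Mathlib

section
/- For every pair of graphs (H,J) such that the complement of H and the graph J are both complete multipartite graphs, there exist integers k, P > 0 such that every {H,J}-free graph admits a ({K_k, S_k}, P)-partition, where K_k is the complete graph on k vertices and S_k is its complement (the edgeless graph on k vertices). -/
/-- A graph `G` contains a graph `H` if some induced subgraph of `G` is isomorphic to `H`. -/
def Contains {α β : Type} (G : SimpleGraph α) (H : SimpleGraph β) : Prop :=
  ∃ s : Set α, Nonempty ((G.induce s) ≃g H)

/-- `G` is `H`-free if `G` does not contain `H`. -/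
def Free {α β : Type} (G : SimpleGraph α) (H : SimpleGraph β) : Prop := ¬ Contains G H

/-- The vertex type `γ` can be partitioned into `P` subsets each of which is a singleton
or satisfies the predicate `Ok`. -/
def HasPartition {γ : Type} (P : ℕ) (Ok : Set γ → Prop) : Prop :=
  ∃ X : Fin P → Set γ, (⋃ i, X i) = Set.univ ∧
    (Pairwise fun i j => Disjoint (X i) (X j)) ∧
    ∀ i, (∃ v, X i = {v}) ∨ Ok (X i)

/-- A complete multipartite graph: the vertex set is partitioned into stable sets
(fibres of `f`) that are pairwise complete to each other. -/
def IsCompleteMultipartite {α : Type} (G : SimpleGraph α) : Prop :=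
  ∃ (ι : Type) (f : α → ι), ∀ u v, G.Adj u v ↔ f u ≠ f v

/-- Finite Ramsey theorem for graphs, with stable sets expressed as cliques of the complement. -/
theorem exists_ramsey_bound (a b : ℕ) : ∃ R : ℕ, ∀ (γ : Type) (G : SimpleGraph γ) (s : Finset γ),
    R ≤ s.card → (∃ t ⊆ s, G.IsNClique a t) ∨ (∃ t ⊆ s, Gᶜ.IsNClique b t) := by
  classical
  induction a generalizing b with
  | zero => exact ⟨0, fun γ G s _ => Or.inl ⟨∅, by simp, by simp [SimpleGraph.isNClique_iff]⟩⟩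
  | succ a iha =>
    induction b with
    | zero => exact ⟨0, fun γ G s _ => Or.inr ⟨∅, by simp, by simp [SimpleGraph.isNClique_iff]⟩⟩
    | succ b ihb =>
      obtain ⟨R₁, h₁⟩ := iha (b + 1)
      obtain ⟨R₂, h₂⟩ := ihb
      refine ⟨R₁ + R₂ + 1, fun γ G s hs => ?_⟩
      obtain ⟨v, hv⟩ : s.Nonempty := Finset.card_pos.1 (by omega)
      have hcard := Finset.card_filter_add_card_filter_not (s := s.erase v) (fun u => G.Adj v u)
      rw [Finset.card_erase_of_mem hv] at hcard
      have hsub : ∀ (p : γ → Prop) [DecidablePred p], (s.erase v).filter p ⊆ s :=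
        fun p _ => (Finset.filter_subset _ _).trans (Finset.erase_subset _ _)
      by_cases h : R₁ ≤ ((s.erase v).filter (fun u => G.Adj v u)).card
      · rcases h₁ γ G _ h with ⟨t, ht, hc⟩ | ⟨t, ht, hc⟩
        · refine Or.inl ⟨insert v t, Finset.insert_subset hv (ht.trans (hsub _)),
            hc.insert fun u hu => (Finset.mem_filter.1 (ht hu)).2⟩
        · exact Or.inr ⟨t, ht.trans (hsub _), hc⟩
      · rcases h₂ γ G ((s.erase v).filter (fun u => ¬ G.Adj v u)) (by omega) with
          ⟨t, ht, hc⟩ | ⟨t, ht, hc⟩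
        · exact Or.inl ⟨t, ht.trans (hsub _), hc⟩
        · refine Or.inr ⟨insert v t, Finset.insert_subset hv (ht.trans (hsub _)),
            hc.insert fun u hu => ?_⟩
          have := Finset.mem_filter.1 (ht hu)
          exact (SimpleGraph.compl_adj _ _ _).2
            ⟨fun e => (Finset.mem_erase.1 this.1).1 e.symm, this.2⟩

/-- Local search in Hamming balls: let `Viol τ F` say that the assignment `τ` violates the
constraint with scope `F`. If all assignments violate some constraint inside `S`, whose scope has
at most `n` elements, then boundedly many variables witness that no assignment close to `σ`
satisfies all constraints. -/
theorem exists_small_unsat {γ : Type} [DecidableEq γ] (n : ℕ)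
    (Viol : (γ → Prop) → Finset γ → Prop)
    (hViol : ∀ σ τ F, (∀ v ∈ F, (σ v ↔ τ v)) → Viol σ F → Viol τ F) (S : Finset γ)
    (hS : ∀ τ, ∃ F ⊆ S, F.card ≤ n ∧ Viol τ F) (D : ℕ) (σ : γ → Prop) :
    ∃ W ⊆ S, W.card ≤ (n + 1) ^ (2 * D + 1) ∧
      ∀ (τ : γ → Prop) (T : Finset γ), T.card ≤ D → (∀ w ∈ W, w ∉ T → (τ w ↔ σ w)) →
        ∃ F ⊆ W, Viol τ F := by
  induction D generalizing σ with
  | zero =>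
    obtain ⟨F, hFS, hFn, hF⟩ := hS σ
    refine ⟨F, hFS, by simp; omega, fun τ T hT h => ⟨F, subset_rfl, hViol σ τ F ?_ hF⟩⟩
    intro v hv
    have : T = ∅ := Finset.card_eq_zero.1 (by omega)
    exact (h v hv (by simp [this])).symm
  | succ D ih =>
    obtain ⟨F, hFS, hFn, hF⟩ := hS σ
    choose W hWS hWc hW using fun v : γ => ih (Function.update σ v (¬ σ v))
    refine ⟨F ∪ F.biUnion W, Finset.union_subset hFS (Finset.biUnion_subset.2 fun v _ => hWS v),
      ?_, fun τ T hT h => ?_⟩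
    · have h1 := Finset.card_union_le F (F.biUnion W)
      have h2 : (F.biUnion W).card ≤ F.card * (n + 1) ^ (2 * D + 1) :=
        Finset.card_biUnion_le_card_mul _ _ _ fun v _ => hWc v
      have h3 : F.card * (n + 1) ^ (2 * D + 1) ≤ n * (n + 1) ^ (2 * D + 1) :=
        Nat.mul_le_mul_right _ hFn
      have h4 : 1 ≤ (n + 1) ^ (2 * D + 1) := Nat.one_le_pow _ _ (by omega)
      calc _ ≤ n + n * (n + 1) ^ (2 * D + 1) := by omega
        _ ≤ (n + 1) ^ (2 * D + 1) * (n + 1) ^ 2 := by nlinarith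
        _ = _ := by rw [← pow_add]; congr 1
    · by_cases hag : ∀ v ∈ F, (σ v ↔ τ v)
      · exact ⟨F, Finset.subset_union_left, hViol σ τ F hag hF⟩
      · push Not at hag
        obtain ⟨v, hvF, hv⟩ := hag
        have hvT : v ∈ T := by
          by_contra hvT
          have := h v (Finset.mem_union_left _ hvF) hvT
          tauto
        have hsub : W v ⊆ F ∪ F.biUnion W :=
          (Finset.subset_biUnion_of_mem W hvF).trans Finset.subset_union_right
        obtain ⟨F', hF', hF'v⟩ := hW v τ (T.erase v)
          (by rw [Finset.card_erase_of_mem hvT]; omega) (by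
            intro w hw hwT
            by_cases hwv : w = v
            · subst hwv
              simp only [Function.update_self]
              tauto
            · rw [Function.update_of_ne hwv]
              exact h w (hsub hw) fun hT => hwT (Finset.mem_erase.2 ⟨hwv, hT⟩))
        exact ⟨F', hF'.trans hsub, hF'v⟩

/-- `IsBadFor G n τ F`: the set `F` is a stable set of size `n` inside `τ`, or a clique of size `n`
outside `τ`. -/
def IsBadFor {γ : Type} (G : SimpleGraph γ) (n : ℕ) (τ : γ → Prop) (F : Finset γ) : Prop :=
  (Gᶜ.IsNClique n F ∧ ∀ v ∈ F, τ v) ∨ (G.IsNClique n F ∧ ∀ v ∈ F, ¬ τ v)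

/-- A graph whose small induced subgraphs all split into a part without stable sets of size `n` and
a part without cliques of size `n` splits in the same way. -/
theorem exists_split_or_small_obstruction (n : ℕ) :
    ∃ w : ℕ, ∀ (γ : Type) (G : SimpleGraph γ) (S : Finset γ),
      (∃ σ : γ → Prop, ∀ F ⊆ S, ¬ IsBadFor G n σ F) ∨
      ∃ W ⊆ S, W.card ≤ w ∧ ∀ τ : γ → Prop, ∃ F ⊆ W, IsBadFor G n τ F := by
  classical
  obtain ⟨R, hR⟩ := exists_ramsey_bound n n
  by_cases hn : n = 0
  · subst hn
    exact ⟨0, fun γ G S => Or.inr ⟨∅, by simp, by simp, fun τ => ⟨∅, by simp,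
      Or.inl ⟨by simp [SimpleGraph.isNClique_iff], by simp⟩⟩⟩⟩
  refine ⟨(n + 1) ^ (2 * (R + R + 1) + 1), fun γ G S => ?_⟩
  induction S using Finset.induction_on with
  | empty =>
    refine Or.inl ⟨fun _ => True, fun F hF hb => ?_⟩
    rw [Finset.subset_empty] at hF
    subst hF
    rcases hb with ⟨h, -⟩ | ⟨h, -⟩ <;> exact hn (by simpa using h.card_eq.symm)
  | insert x S hx ih =>
    rcases ih with ⟨σ, hσ⟩ | ⟨W, hWS, hWc, hW⟩
    swap
    · exact Or.inr ⟨W, hWS.trans (Finset.subset_insert _ _), hWc, hW⟩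
    by_cases hsplit : ∃ τ : γ → Prop, ∀ F ⊆ insert x S, ¬ IsBadFor G n τ F
    · exact Or.inl hsplit
    push Not at hsplit
    refine Or.inr ?_
    obtain ⟨W, hWS, hWc, hW⟩ := exists_small_unsat n (IsBadFor G n)
      (by
        rintro σ τ F h (⟨h1, h2⟩ | ⟨h1, h2⟩)
        · exact Or.inl ⟨h1, fun v hv => (h v hv).1 (h2 v hv)⟩
        · exact Or.inr ⟨h1, fun v hv hτ => h2 v hv ((h v hv).2 hτ)⟩)
      (insert x S)
      (fun τ => by
        obtain ⟨F, hF, hb⟩ := hsplit τ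
        exact ⟨F, hF, by rcases hb with h | h <;> exact h.1.card_eq.le, hb⟩)
      (R + R + 1) σ
    refine ⟨W, hWS, hWc, fun τ => ?_⟩
    by_contra hτ
    push Not at hτ
    have hWx : ∀ (p : γ → Prop) [DecidablePred p], (W.erase x).filter p ⊆ S := fun p _ v hv => by
      have h1 := Finset.mem_erase.1 (Finset.mem_filter.1 hv).1
      exact (Finset.mem_insert.1 (hWS h1.2)).resolve_left h1.1
    have hWW : ∀ (p : γ → Prop) [DecidablePred p], (W.erase x).filter p ⊆ W :=
      fun p _ => (Finset.filter_subset _ _).trans (Finset.erase_subset _ _)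
    have hsmall : ∀ ρ ρ' : γ → Prop, ∀ A : Finset γ,
        A ⊆ (W.erase x).filter (fun v => ρ v ∧ ¬ ρ' v) →
        (∀ F ⊆ A, ¬ IsBadFor G n ρ F) → (∀ F ⊆ A, ¬ IsBadFor G n ρ' F) → A.card < R := by
      intro ρ ρ' A hA h1 h2
      by_contra hc
      rcases hR γ G A (by omega) with ⟨t, ht, hc⟩ | ⟨t, ht, hc⟩
      · exact h2 t ht (Or.inr ⟨hc, fun v hv => (Finset.mem_filter.1 (hA (ht hv))).2.2⟩)
      · exact h1 t ht (Or.inl ⟨hc, fun v hv => (Finset.mem_filter.1 (hA (ht hv))).2.1⟩)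
    have hA := hsmall σ τ _ subset_rfl (fun F hF => hσ F (hF.trans (hWx _)))
      (fun F hF => hτ F (hF.trans (hWW _)))
    have hB := hsmall τ σ _ subset_rfl (fun F hF => hτ F (hF.trans (hWW _)))
      (fun F hF => hσ F (hF.trans (hWx _)))
    obtain ⟨F, hF, hb⟩ := hW τ (insert x ((W.erase x).filter (fun v => σ v ∧ ¬ τ v) ∪
        (W.erase x).filter (fun v => τ v ∧ ¬ σ v)))
      ((Finset.card_insert_le _ _).trans
        (by
          have := Finset.card_union_le ((W.erase x).filter (fun v => σ v ∧ ¬ τ v))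
            ((W.erase x).filter (fun v => τ v ∧ ¬ σ v))
          omega))
      (by
        intro w hw hwT
        simp only [Finset.mem_insert, Finset.mem_union, Finset.mem_filter, Finset.mem_erase] at hwT
        tauto)
    exact hτ F hF hb

/-- `HasCliqueFamily G n a X`: the set `X` contains `a` disjoint, pairwise anticomplete cliques of
size `n`. -/
def HasCliqueFamily {γ : Type} (G : SimpleGraph γ) (n : ℕ) : ℕ → Set γ → Prop
  | 0, _ => True
  | a + 1, X => ∃ F : Finset γ, G.IsNClique n F ∧ (F : Set γ) ⊆ X ∧
      HasCliqueFamily G n a {u ∈ X | ∀ v ∈ F, u ≠ v ∧ ¬ G.Adj u v}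

theorem HasCliqueFamily.mono {γ : Type} {G : SimpleGraph γ} {n a : ℕ} {X Y : Set γ} (hXY : X ⊆ Y)
    (h : HasCliqueFamily G n a X) : HasCliqueFamily G n a Y := by
  induction a generalizing X Y with
  | zero => trivial
  | succ a ih =>
    obtain ⟨F, hF, hFX, h⟩ := h
    exact ⟨F, hF, hFX.trans hXY, ih (fun u hu => ⟨hXY hu.1, hu.2⟩) h⟩

theorem HasCliqueFamily.exists_fun {γ : Type} {G : SimpleGraph γ} {n a : ℕ} {X : Set γ}
    (h : HasCliqueFamily G n a X) :
    ∃ F : Fin a → Finset γ, (∀ i, G.IsNClique n (F i) ∧ (F i : Set γ) ⊆ X) ∧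
      ∀ i j, i ≠ j → ∀ u ∈ F i, ∀ v ∈ F j, u ≠ v ∧ ¬ G.Adj u v := by
  induction a generalizing X with
  | zero => exact ⟨fun i => i.elim0, fun i => i.elim0, fun i => i.elim0⟩
  | succ a ih =>
    obtain ⟨F, hF, hFX, h⟩ := h
    obtain ⟨F', h1, h2⟩ := ih h
    refine ⟨Fin.cons F F', fun i => ?_, fun i j => ?_⟩
    · refine Fin.cases ⟨hF, hFX⟩ (fun i => ⟨(h1 i).1, fun u hu => ((h1 i).2 hu).1⟩) i
    · refine Fin.cases (Fin.cases (fun h => absurd rfl h) (fun j _ u hu v hv => ?_) j)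
        (fun i => Fin.cases (fun _ u hu v hv => ?_) (fun j hij => ?_) j) i
      · have := ((h1 j).2 hv).2 u hu
        exact ⟨this.1.symm, fun h => this.2 h.symm⟩
      · exact ((h1 i).2 hu).2 v hv
      · exact h2 i j fun e => hij (by rw [e])

theorem contains_of_embedding {γ α : Type} {G : SimpleGraph γ} {H : SimpleGraph α} (φ : α → γ)
    (hφ : Function.Injective φ) (h : ∀ u v, G.Adj (φ u) (φ v) ↔ H.Adj u v) : Contains G H :=
  ⟨Set.range φ, ⟨RelIso.symm ⟨Equiv.ofInjective φ hφ, fun {u v} => h u v⟩⟩⟩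

theorem Contains.exists_embedding {γ α : Type} {G : SimpleGraph γ} {H : SimpleGraph α}
    (h : Contains G H) :
    ∃ φ : α → γ, Function.Injective φ ∧ ∀ u v, G.Adj (φ u) (φ v) ↔ H.Adj u v := by
  obtain ⟨s, ⟨e⟩⟩ := h
  exact ⟨fun u => (e.symm u : γ), Subtype.val_injective.comp e.symm.injective,
    fun u v => e.symm.map_adj_iff⟩

theorem Contains.compl {γ α : Type} {G : SimpleGraph γ} {H : SimpleGraph α}
    (h : Contains G H) : Contains Gᶜ Hᶜ := by
  obtain ⟨φ, hφ, h⟩ := h.exists_embedding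
  exact contains_of_embedding φ hφ fun u v => by
    simp only [SimpleGraph.compl_adj, h, hφ.ne_iff]

theorem HasCliqueFamily.contains {γ α : Type} [Fintype α] {G : SimpleGraph γ} {H : SimpleGraph α}
    (hH : IsCompleteMultipartite Hᶜ) {n : ℕ} (hn : Fintype.card α ≤ n) {X : Set γ}
    (h : HasCliqueFamily G n n X) : Contains G H := by
  classical
  obtain ⟨ι, f, hf⟩ := hH
  obtain ⟨F, hF, hFF⟩ := h.exists_fun
  obtain ⟨e⟩ : Nonempty (α ↪ Fin n) :=
    Function.Embedding.nonempty_of_card_le (by simpa using hn)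
  have hrep : ∀ u, ∃ v, f v = f u := fun u => ⟨u, rfl⟩
  obtain ⟨c, hc⟩ : ∃ c : α → Fin n, ∀ u v, c u = c v ↔ f u = f v := by
    refine ⟨fun u => e (hrep u).choose, fun u v => ?_⟩
    rw [e.injective.eq_iff]
    constructor
    · intro h
      rw [← (hrep u).choose_spec, h, (hrep v).choose_spec]
    · intro h
      simp only [h]
  let g : ∀ i, Fin n ≃ F i := fun i => ((F i).equivFinOfCardEq (hF i).1.card_eq).symm
  have hg : ∀ u, (g (c u) (e u) : γ) ∈ F (c u) := fun u => (g (c u) (e u)).2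
  have hinj : ∀ u v, u ≠ v → c u = c v → (g (c u) (e u) : γ) ≠ g (c v) (e v) := by
    intro u v huv hcuv
    rw [hcuv]
    exact fun h => huv (e.injective ((g _).injective (Subtype.ext h)))
  refine contains_of_embedding (fun u => (g (c u) (e u) : γ)) ?_ fun u v => ?_
  · intro u v huv
    by_contra hne
    by_cases hcuv : c u = c v
    · exact hinj u v hne hcuv huv
    · exact (hFF _ _ hcuv _ (hg u) _ (hg v)).1 huv
  · have hfuv := hf u v
    rw [SimpleGraph.compl_adj] at hfuv
    by_cases huv : u = v
    · subst huv; simp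
    by_cases hcuv : c u = c v
    · have h1 : H.Adj u v := by
        have := (hc u v).1 hcuv
        tauto
      have h2 := (hF (c v)).1.isClique (hcuv ▸ hg u) (hg v) (hinj u v huv hcuv)
      exact iff_of_true h2 h1
    · have h1 : ¬ H.Adj u v := by
        have := mt (hc u v).2 hcuv
        tauto
      exact iff_of_false (hFF _ _ hcuv _ (hg u) _ (hg v)).2 h1

/-- `IsCoverable G n P X`: the set `X` is covered by at most `P` sets, each without cliques of
size `n` or without stable sets of size `n`. -/
def IsCoverable {γ : Type} (G : SimpleGraph γ) (n P : ℕ) (X : Set γ) : Prop :=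
  ∃ 𝒮 : Finset (Set γ), 𝒮.card ≤ P ∧ X ⊆ ⋃₀ (𝒮 : Set (Set γ)) ∧
    ∀ Y ∈ 𝒮, G.CliqueFreeOn Y n ∨ Gᶜ.CliqueFreeOn Y n

theorem IsCoverable.of_mem {γ : Type} {G : SimpleGraph γ} {n : ℕ} {X : Set γ}
    (h : G.CliqueFreeOn X n ∨ Gᶜ.CliqueFreeOn X n) : IsCoverable G n 1 X :=
  ⟨{X}, by simp, by simp, by simpa using h⟩

theorem IsCoverable.mono {γ : Type} {G : SimpleGraph γ} {n P Q : ℕ} {X Y : Set γ}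
    (hPQ : P ≤ Q) (hYX : Y ⊆ X) (h : IsCoverable G n P X) : IsCoverable G n Q Y := by
  obtain ⟨𝒮, h1, h2, h3⟩ := h
  exact ⟨𝒮, h1.trans hPQ, hYX.trans h2, h3⟩

theorem IsCoverable.union {γ : Type} {G : SimpleGraph γ} {n P Q : ℕ} {X Y : Set γ}
    (hX : IsCoverable G n P X) (hY : IsCoverable G n Q Y) : IsCoverable G n (P + Q) (X ∪ Y) := by
  classical
  obtain ⟨𝒮, h1, h2, h3⟩ := hX
  obtain ⟨𝒯, h4, h5, h6⟩ := hY
  refine ⟨𝒮 ∪ 𝒯, (Finset.card_union_le _ _).trans (add_le_add h1 h4), ?_, fun Z hZ => ?_⟩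
  · rw [Finset.coe_union, Set.sUnion_union]
    exact Set.union_subset_union h2 h5
  · rcases Finset.mem_union.1 hZ with h | h
    exacts [h3 Z h, h6 Z h]

theorem IsCoverable.biUnion {γ ι : Type} {G : SimpleGraph γ} {n P : ℕ} (s : Finset ι)
    (X : ι → Set γ) (h : ∀ i ∈ s, IsCoverable G n P (X i)) :
    IsCoverable G n (s.card * P) (⋃ i ∈ s, X i) := by
  classical
  induction s using Finset.induction_on with
  | empty => exact ⟨∅, by simp, by simp, by simp⟩
  | insert i s hi ih =>
    rw [Finset.set_biUnion_insert, Finset.card_insert_of_notMem hi, add_mul, one_mul, add_comm]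
    exact (h i (by simp)).union (ih fun j hj => h j (Finset.mem_insert_of_mem hj))

theorem exists_isCoverable (n : ℕ) (hn : 2 ≤ n) (a b : ℕ) :
    ∃ P : ℕ, ∀ (γ : Type) [Fintype γ] (G : SimpleGraph γ) (X : Set γ),
      ¬ HasCliqueFamily G n a X → ¬ HasCliqueFamily Gᶜ n b X → IsCoverable G n P X := by
  classical
  induction a generalizing b with
  | zero => exact ⟨0, fun γ _ G X h => absurd trivial h⟩
  | succ a iha =>
    induction b with
    | zero => exact ⟨0, fun γ _ G X _ h => absurd trivial h⟩
    | succ b ihb =>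
      obtain ⟨P₁, h₁⟩ := iha (b + 1)
      obtain ⟨P₂, h₂⟩ := ihb
      obtain ⟨w, hw⟩ := exists_split_or_small_obstruction n
      refine ⟨2 + (w * 1 + (2 ^ w * P₁ + 2 ^ w * P₂)), fun γ _ G X hG hGc => ?_⟩
      rcases hw γ G X.toFinset with ⟨σ, hσ⟩ | ⟨W, hWX, hWc, hW⟩
      · have hA : IsCoverable G n 1 {u ∈ X | σ u} := .of_mem <| Or.inr fun t ht hc =>
          hσ t (fun u hu => by simpa using (ht hu).1) (Or.inl ⟨hc, fun v hv => (ht hv).2⟩)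
        have hB : IsCoverable G n 1 {u ∈ X | ¬ σ u} := .of_mem <| Or.inl fun t ht hc =>
          hσ t (fun u hu => by simpa using (ht hu).1) (Or.inr ⟨hc, fun v hv => (ht hv).2⟩)
        refine (hA.union hB).mono (by omega) fun u hu => ?_
        by_cases h : σ u
        exacts [Or.inl ⟨hu, h⟩, Or.inr ⟨hu, h⟩]
      have hWX' : ∀ u ∈ W, u ∈ X := fun u hu => by simpa using hWX hu
      have hsing : IsCoverable G n (W.card * 1) (⋃ u ∈ W, {u}) := by
        refine .biUnion W _ fun u _ => .of_mem <| Or.inl fun t ht hc => ?_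
        have h1 := Finset.card_le_card (show t ⊆ {u} by exact_mod_cast ht)
        have h2 := hc.card_eq
        rw [Finset.card_singleton] at h1
        omega
      have hcard : ∀ (p : Finset γ → Prop) [DecidablePred p],
          (W.powerset.filter p).card ≤ 2 ^ w := fun p _ =>
        (Finset.card_filter_le _ _).trans
          (by rw [Finset.card_powerset]; exact Nat.pow_le_pow_right (by omega) hWc)
      have hFX : ∀ {p : Finset γ → Prop} [DecidablePred p],
          ∀ F ∈ W.powerset.filter p, (F : Set γ) ⊆ X :=
        fun F hF u hu => hWX' u (Finset.mem_powerset.1 (Finset.mem_filter.1 hF).1 hu)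
      have hcliques := IsCoverable.biUnion (W.powerset.filter fun F => G.IsNClique n F)
        (fun F => {u ∈ X | ∀ v ∈ F, u ≠ v ∧ ¬ G.Adj u v}) fun F hF => h₁ γ G _
          (fun h => hG ⟨F, (Finset.mem_filter.1 hF).2, hFX F hF, h⟩)
          (fun h => hGc (h.mono fun u hu => hu.1))
      have hstable := IsCoverable.biUnion (W.powerset.filter fun F => Gᶜ.IsNClique n F)
        (fun F => {u ∈ X | ∀ v ∈ F, u ≠ v ∧ ¬ Gᶜ.Adj u v}) fun F hF => h₂ γ G _
          (fun h => hG (h.mono fun u hu => hu.1))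
          (fun h => hGc ⟨F, (Finset.mem_filter.1 hF).2, hFX F hF, h⟩)
      refine (hsing.union (hcliques.union hstable)).mono ?_ fun u hu => ?_
      · have h1 := Nat.mul_le_mul_right P₁ (hcard fun F => G.IsNClique n F)
        have h2 := Nat.mul_le_mul_right P₂ (hcard fun F => Gᶜ.IsNClique n F)
        omega
      · by_cases huW : u ∈ W
        · exact Or.inl (by simpa using huW)
        refine Or.inr ?_
        obtain ⟨F, hFW, hF⟩ := hW (fun v => G.Adj u v)
        have hne : ∀ v ∈ F, u ≠ v := fun v hv e => huW (e ▸ hFW hv)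
        rcases hF with ⟨hc, hF⟩ | ⟨hc, hF⟩
        · refine Or.inr (Set.mem_biUnion
            (Finset.mem_filter.2 ⟨Finset.mem_powerset.2 hFW, hc⟩) ⟨hu, fun v hv => ⟨hne v hv, ?_⟩⟩)
          simp [hF v hv]
        · exact Or.inl (Set.mem_biUnion
            (Finset.mem_filter.2 ⟨Finset.mem_powerset.2 hFW, hc⟩)
            ⟨hu, fun v hv => ⟨hne v hv, hF v hv⟩⟩)

theorem IsCoverable.hasPartition {γ : Type} {G : SimpleGraph γ} {n P : ℕ}
    (hn : n ≠ 0) (h : IsCoverable G n P Set.univ) :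
    HasPartition P (fun X => G.CliqueFreeOn X n ∨ Gᶜ.CliqueFreeOn X n) := by
  obtain ⟨𝒮, hcard, hcov, hfree⟩ := h
  obtain ⟨e⟩ : Nonempty (𝒮 ↪ Fin P) :=
    Function.Embedding.nonempty_of_card_le (by simpa using hcard)
  have hmem : ∀ u, ∃ Y : 𝒮, u ∈ (Y : Set γ) := fun u => by
    obtain ⟨Y, hY, hu⟩ := hcov (Set.mem_univ u)
    exact ⟨⟨Y, hY⟩, hu⟩
  choose Y hY using hmem
  refine ⟨fun i => {u | e (Y u) = i}, ?_, fun i j hij => ?_, fun i => Or.inr ?_⟩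
  · exact Set.eq_univ_of_forall fun u => Set.mem_iUnion.2 ⟨e (Y u), rfl⟩
  · exact Set.disjoint_left.2 fun u hi hj => hij (hi.symm.trans hj)
  · by_cases hi : ∃ Z, e Z = i
    · obtain ⟨Z, rfl⟩ := hi
      have hsub : {u | e (Y u) = e Z} ⊆ (Z : Set γ) := fun u hu => e.injective hu ▸ hY u
      exact (hfree Z Z.2).imp (.subset _ hsub) (.subset _ hsub)
    · have hempty : {u | e (Y u) = i} = ∅ := Set.eq_empty_of_forall_notMem fun u hu => hi ⟨_, hu⟩
      exact Or.inl (.subset _ hempty.subset ((SimpleGraph.cliqueFreeOn_empty _).2 hn))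

theorem free_induce_of_cliqueFreeOn {γ : Type} {G : SimpleGraph γ} {n : ℕ} {X : Set γ}
    (h : G.CliqueFreeOn X n) : Free (G.induce X) (⊤ : SimpleGraph (Fin n)) := by
  intro hc
  obtain ⟨φ, hφ, hadj⟩ := hc.exists_embedding
  let ψ : Fin n ↪ γ := ⟨fun i => φ i, Subtype.val_injective.comp hφ⟩
  refine h (t := Finset.univ.map ψ) ?_ ⟨?_, by simp⟩
  · intro u hu
    obtain ⟨i, -, rfl⟩ := Finset.mem_map.1 hu
    exact (φ i).2
  · intro u hu v hv huv
    obtain ⟨i, -, rfl⟩ := Finset.mem_map.1 hu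
    obtain ⟨j, -, rfl⟩ := Finset.mem_map.1 hv
    exact (hadj i j).2 fun e => huv (by rw [e])

/-- For every pair of graphs (H,J) such that `Hᶜ` and `J` are complete multipartite,
there exist integers `k, P > 0` such that every `{H,J}`-free graph admits a
`({K_k, S_k}, P)`-partition. -/
theorem stmt0 {α β : Type} [Fintype α] [Fintype β]
    (H : SimpleGraph α) (J : SimpleGraph β)
    (hH : IsCompleteMultipartite Hᶜ) (hJ : IsCompleteMultipartite J) :
    ∃ k P : ℕ, 0 < k ∧ 0 < P ∧
      ∀ (γ : Type) [Fintype γ] (G : SimpleGraph γ), Free G H → Free G J →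
        HasPartition P (fun X : Set γ =>
          Free (G.induce X) (⊤ : SimpleGraph (Fin k)) ∨
          Free (G.induce X) (⊥ : SimpleGraph (Fin k))) := by
  obtain ⟨n, hn, hα, hβ⟩ : ∃ n, 2 ≤ n ∧ Fintype.card α ≤ n ∧ Fintype.card β ≤ n :=
    ⟨2 + Fintype.card α + Fintype.card β, by omega, by omega, by omega⟩
  obtain ⟨P, hP⟩ := exists_isCoverable n hn n n
  refine ⟨n, P + 1, by omega, by omega, fun γ _ G hGH hGJ => ?_⟩
  have hcov : IsCoverable G n P Set.univ := hP γ G Set.univ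
    (fun h => hGH (h.contains hH hα))
    (fun h => hGJ (by
      have := (h.contains (H := Jᶜ) (by rwa [compl_compl]) hβ).compl
      rwa [compl_compl, compl_compl] at this))
  obtain ⟨X, h1, h2, h3⟩ := (hcov.mono P.le_succ subset_rfl).hasPartition (by omega)
  refine ⟨X, h1, h2, fun i => (h3 i).imp_right (Or.imp (free_induce_of_cliqueFreeOn) fun h hc => ?_)⟩
  refine free_induce_of_cliqueFreeOn h ?_
  have := hc.compl
  have hcompl : (G.induce (X i))ᶜ = Gᶜ.induce (X i) := by
    ext u v
    simp [Subtype.ext_iff]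
  rwa [compl_bot, hcompl] at this
end

section
/- For every pair of non-null graphs (H,J) there exists an integer P > 0 such that every {H,J}-free graph admits a (c(H) ∪ ac(J), P)-partition. -/
/-- `Cover Ok k S`: the set `S` can be covered by at most `k` sets satisfying `Ok`. -/
def Cover {γ : Type*} (Ok : Set γ → Prop) (k : ℕ) (S : Set γ) : Prop :=
  ∃ F : Finset (Set γ), F.card ≤ k ∧ S ⊆ ⋃₀ (F : Set (Set γ)) ∧ ∀ X ∈ F, Ok X

namespace Cover

variable {γ : Type*} {Ok : Set γ → Prop}

theorem mono {k l : ℕ} {S T : Set γ} (h : Cover Ok k S) (hkl : k ≤ l) (hTS : T ⊆ S) :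
    Cover Ok l T := by
  obtain ⟨F, hF, hS, hOk⟩ := h
  exact ⟨F, hF.trans hkl, hTS.trans hS, hOk⟩

theorem empty : Cover Ok 0 (∅ : Set γ) := ⟨∅, by simp⟩

theorem of_ok {S : Set γ} (h : Ok S) : Cover Ok 1 S := ⟨{S}, by simpa using h⟩

theorem union {k l : ℕ} {S T : Set γ} (hS : Cover Ok k S) (hT : Cover Ok l T) :
    Cover Ok (k + l) (S ∪ T) := by
  classical
  obtain ⟨F, hF, hFS, hFOk⟩ := hS
  obtain ⟨F', hF', hFT, hFOk'⟩ := hT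
  refine ⟨F ∪ F', (Finset.card_union_le _ _).trans (by omega), ?_, ?_⟩
  · rw [Finset.coe_union, Set.sUnion_union]
    exact Set.union_subset_union hFS hFT
  · intro X hX
    rcases Finset.mem_union.1 hX with h | h
    exacts [hFOk X h, hFOk' X h]

theorem biUnion {ι : Type*} {k : ℕ} {S : ι → Set γ} (I : Finset ι)
    (h : ∀ i ∈ I, Cover Ok k (S i)) : Cover Ok (I.card * k) (⋃ i ∈ I, S i) := by
  classical
  induction I using Finset.induction_on with
  | empty => simpa using (empty (Ok := Ok))
  | insert a I ha ih =>
    rw [Finset.set_biUnion_insert, Finset.card_insert_of_notMem ha, add_mul, one_mul, add_comm]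
    exact (h a (by simp)).union (ih fun i hi => h i (by simp [hi]))

theorem hasPartition {γ : Type} {Ok Ok' : Set γ → Prop} {k : ℕ} (h : Cover Ok k Set.univ)
    (hmono : ∀ S T, T ⊆ S → Ok S → Ok T) (hempty : Ok ∅)
    (hOk : ∀ S, Ok S → (∃ v, S = {v}) ∨ Ok' S) : HasPartition k Ok' := by
  obtain ⟨F, hF, hS, hFOk⟩ := h
  let X : Fin k → Set γ := fun i =>
    if hi : (i : ℕ) < F.card then (F.equivFin.symm ⟨i, hi⟩ : Set γ) else ∅
  have hX : ∀ i, Ok (X i) := by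
    intro i
    by_cases hi : (i : ℕ) < F.card
    · simpa [X, hi] using hFOk _ (F.equivFin.symm ⟨i, hi⟩).2
    · simpa [X, hi] using hempty
  refine ⟨disjointed X, ?_, disjoint_disjointed X, fun i =>
    hOk _ (hmono _ _ (disjointed_le X i) (hX i))⟩
  rw [iUnion_disjointed, Set.eq_univ_iff_forall]
  intro v
  obtain ⟨Y, hY, hv⟩ := hS (Set.mem_univ v)
  have hlt := (F.equivFin ⟨Y, hY⟩).2
  refine Set.mem_iUnion.2 ⟨⟨F.equivFin ⟨Y, hY⟩, hlt.trans_le hF⟩, ?_⟩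
  simpa [X] using hv

end Cover

namespace SimpleGraph

/-- `f` maps the subgraph of `H` induced by `s` isomorphically to an induced subgraph of `G`
with vertices in `W`. -/
def IsCopyOn {α γ : Type*} (H : SimpleGraph α) (s : Set α) (G : SimpleGraph γ) (W : Set γ)
    (f : α → γ) : Prop :=
  Set.MapsTo f s W ∧ Set.InjOn f s ∧ ∀ x ∈ s, ∀ y ∈ s, G.Adj (f x) (f y) ↔ H.Adj x y

/-- The subgraph of `G` induced by `W` has no induced subgraph isomorphic to the subgraph of `H`
induced by `s`. -/
def FreeOn {α γ : Type*} (H : SimpleGraph α) (s : Set α) (G : SimpleGraph γ) (W : Set γ) : Prop :=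
  ∀ f, ¬ H.IsCopyOn s G W f

section

variable {α γ : Type*} {H : SimpleGraph α} {s : Set α} {G : SimpleGraph γ} {W : Set γ}

theorem FreeOn.mono {W' : Set γ} (h : H.FreeOn s G W) (hW : W' ⊆ W) : H.FreeOn s G W' :=
  fun f hf => h f ⟨hf.1.mono_right hW, hf.2⟩

theorem FreeOn.empty (hs : s.Nonempty) : H.FreeOn s G ∅ :=
  fun _ hf => hf.1 hs.choose_spec

theorem isCopyOn_compl {f : α → γ} : Hᶜ.IsCopyOn s Gᶜ W f ↔ H.IsCopyOn s G W f := by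
  refine and_congr_right fun _ => and_congr_right fun hinj => ?_
  refine forall₂_congr fun x hx => forall₂_congr fun y hy => ?_
  simp only [compl_adj, ne_eq, hinj.eq_iff hx hy]
  by_cases hxy : x = y <;> simp [hxy, not_iff_not]

theorem freeOn_compl : Hᶜ.FreeOn s Gᶜ W ↔ H.FreeOn s G W :=
  forall_congr' fun _ => not_congr isCopyOn_compl

theorem IsCopyOn.piecewise {s₁ s₂ : Set α} {f g : α → γ} [∀ x, Decidable (x ∈ s₁)]
    (hf : H.IsCopyOn s₁ G W f) (hg : H.IsCopyOn s₂ G W g)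
    (hH : ∀ x ∈ s₁, ∀ y ∈ s₂, ¬ H.Adj x y)
    (hG : ∀ x ∈ s₁, ∀ y ∈ s₂, g y ≠ f x ∧ ¬ G.Adj (f x) (g y)) :
    H.IsCopyOn (s₁ ∪ s₂) G W (s₁.piecewise f g) := by
  obtain ⟨hfm, hfi, hfa⟩ := hf
  obtain ⟨hgm, hgi, hga⟩ := hg
  have key : ∀ x ∈ s₁ ∪ s₂, (x ∈ s₁ ∧ s₁.piecewise f g x = f x) ∨
      (x ∈ s₂ ∧ s₁.piecewise f g x = g x) := by
    intro x hx
    by_cases h : x ∈ s₁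
    · exact Or.inl ⟨h, by simp [h]⟩
    · exact Or.inr ⟨hx.resolve_left h, by simp [h]⟩
  refine ⟨fun x hx => ?_, fun x hx y hy hxy => ?_, fun x hx y hy => ?_⟩
  · rcases key x hx with ⟨h, e⟩ | ⟨h, e⟩ <;> rw [e]
    exacts [hfm h, hgm h]
  · rcases key x hx with ⟨h, e⟩ | ⟨h, e⟩ <;> rcases key y hy with ⟨h', e'⟩ | ⟨h', e'⟩ <;>
      rw [e, e'] at hxy
    · exact hfi h h' hxy
    · exact absurd hxy.symm (hG x h y h').1
    · exact absurd hxy (hG y h' x h).1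
    · exact hgi h h' hxy
  · rcases key x hx with ⟨h, e⟩ | ⟨h, e⟩ <;> rcases key y hy with ⟨h', e'⟩ | ⟨h', e'⟩ <;>
      rw [e, e']
    · exact hfa x h y h'
    · exact iff_of_false (hG x h y h').2 (hH x h y h')
    · exact iff_of_false (fun t => (hG y h' x h).2 t.symm) fun t => hH y h' x h t.symm
    · exact hga x h y h'

/-- If `W` has no copy of the disjoint union of `H[s₁]` and `H[s₂]`, and `X ⊆ W` is hard to cover,
then the vertices whose neighbourhood in `X` is easy to cover induce no copy of `H[s₁]`. -/
theorem FreeOn.of_cover_inter_neighborSet [Fintype α] {s₁ s₂ : Set α}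
    (hH : ∀ x ∈ s₁, ∀ y ∈ s₂, ¬ H.Adj x y) (hW : H.FreeOn (s₁ ∪ s₂) G W)
    {Ok : Set γ → Prop} (hOk : ∀ v, Ok {v}) {p k : ℕ}
    (hp : ∀ Y ⊆ W, H.FreeOn s₂ G Y → Cover Ok p Y) {X : Set γ} (hXW : X ⊆ W)
    (hX : ¬ Cover Ok (Fintype.card α * (k + 1) + p) X) :
    H.FreeOn s₁ G {v ∈ W | Cover Ok k (X ∩ G.neighborSet v)} := by
  classical
  intro f hf
  let Y : Set γ := {y ∈ X | ∀ a ∈ s₁, y ≠ f a ∧ ¬ G.Adj (f a) y}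
  have hY : Cover Ok p Y := by
    refine hp Y (fun y hy => hXW hy.1) fun g hg => ?_
    refine hW _ (IsCopyOn.piecewise ⟨fun x hx => (hf.1 hx).1, hf.2⟩
      ⟨fun x hx => hXW (hg.1 hx).1, hg.2⟩ hH fun x hx y hy => (hg.1 hy).2 x hx)
  have hN : Cover Ok ((s₁.toFinset).card * (k + 1))
      (⋃ a ∈ s₁.toFinset, (X ∩ G.neighborSet (f a)) ∪ {f a}) :=
    Cover.biUnion _ fun a ha => (hf.1 (Set.mem_toFinset.1 ha)).2.union (Cover.of_ok (hOk _))
  refine hX ((hN.union hY).mono ?_ fun x hx => ?_)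
  · gcongr
    exact Finset.card_le_univ _
  · by_cases hxY : x ∈ Y
    · exact Or.inr hxY
    · left
      have : ∃ a ∈ s₁, x ≠ f a → G.Adj (f a) x := by
        by_contra! hcon
        exact hxY ⟨hx, hcon⟩
      obtain ⟨a, ha, hadj⟩ := this
      simp only [Set.mem_iUnion]
      refine ⟨a, Set.mem_toFinset.2 ha, ?_⟩
      by_cases hxa : x = f a
      · exact Or.inr hxa
      · exact Or.inl ⟨hx, hadj hxa⟩

end

/-- Covering threshold above which every graph on `n` vertices can be embedded greedily. -/
def embedThreshold (m p : ℕ) : ℕ → ℕ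
  | 0 => 0
  | n + 1 => m * (embedThreshold m p n + 1) + p + n * (p + p)

/-- Greedy embedding: if in every subset of `W` that is hard to cover most vertices have both a
hard-to-cover neighbourhood and a hard-to-cover non-neighbourhood, then every graph embeds with
prescribed hard-to-cover candidate sets for its vertices. -/
theorem exists_embedding_of_not_cover {γ : Type*} {G : SimpleGraph γ} {W : Set γ}
    {Ok : Set γ → Prop} {m p : ℕ}
    (hpos : ∀ k, ∀ X ⊆ W, ¬ Cover Ok (m * (k + 1) + p) X →
      Cover Ok p {v ∈ W | Cover Ok k (X ∩ G.neighborSet v)})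
    (hneg : ∀ k, ∀ X ⊆ W, ¬ Cover Ok (m * (k + 1) + p) X →
      Cover Ok p {v ∈ W | Cover Ok k (X ∩ Gᶜ.neighborSet v)})
    (n : ℕ) (K : SimpleGraph (Fin n)) (X : Fin n → Set γ) (hXW : ∀ i, X i ⊆ W)
    (hX : ∀ i, ¬ Cover Ok (embedThreshold m p n) (X i)) :
    ∃ f : K ↪g G, ∀ i, f i ∈ X i := by
  classical
  induction n with
  | zero => exact ⟨⟨⟨Fin.elim0, fun i => i.elim0⟩, fun {i} => i.elim0⟩, fun i => i.elim0⟩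
  | succ n ih =>
    set k := embedThreshold m p n with hk
    have hthr : embedThreshold m p (n + 1) = m * (k + 1) + p + n * (p + p) := rfl
    have hX' : ∀ i, ¬ Cover Ok (m * (k + 1) + p) (X i) := fun i h =>
      hX i (h.mono (by omega) subset_rfl)
    let B : Fin n → Set γ := fun i =>
      {v ∈ W | Cover Ok k (X i.succ ∩ G.neighborSet v)} ∪
        {v ∈ W | Cover Ok k (X i.succ ∩ Gᶜ.neighborSet v)}
    have hB : Cover Ok (n * (p + p)) (⋃ i ∈ (Finset.univ : Finset (Fin n)), B i) := by
      have := Cover.biUnion (Finset.univ : Finset (Fin n)) (S := B) fun i _ =>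
        (hpos k _ (hXW i.succ) (hX' _)).union (hneg k _ (hXW i.succ) (hX' _))
      rwa [Finset.card_univ, Fintype.card_fin] at this
    obtain ⟨v, hvX, hvB⟩ : ∃ v ∈ X 0, v ∉ ⋃ i ∈ (Finset.univ : Finset (Fin n)), B i := by
      by_contra! hcon
      exact hX 0 (hB.mono (by omega) hcon)
    have hvB' : ∀ i : Fin n, ¬ Cover Ok k (X i.succ ∩ G.neighborSet v) ∧
        ¬ Cover Ok k (X i.succ ∩ Gᶜ.neighborSet v) := by
      refine fun i => ⟨fun h => hvB ?_, fun h => hvB ?_⟩ <;>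
        refine Set.mem_biUnion (Finset.mem_coe.2 (Finset.mem_univ i)) ?_
      exacts [Or.inl ⟨hXW 0 hvX, h⟩, Or.inr ⟨hXW 0 hvX, h⟩]
    obtain ⟨f, hf⟩ := ih (K.comap Fin.succ)
      (fun i => X i.succ ∩
        if K.Adj 0 i.succ then G.neighborSet v else Gᶜ.neighborSet v)
      (fun i => Set.inter_subset_left.trans (hXW _))
      (fun i => by
        split_ifs
        exacts [(hvB' i).1, (hvB' i).2])
    have hadj : ∀ i, v ≠ f i ∧ (G.Adj v (f i) ↔ K.Adj 0 i.succ) := by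
      intro i
      have := (hf i).2
      split_ifs at this with h
      · exact ⟨G.ne_of_adj this, iff_of_true this h⟩
      · rw [mem_neighborSet, compl_adj] at this
        exact ⟨this.1, iff_of_false this.2 h⟩
    refine ⟨⟨⟨Fin.cons v f, ?_⟩, ?_⟩, ?_⟩
    · refine Fin.cons_injective_iff.2 ⟨?_, f.injective⟩
      rintro ⟨i, hi⟩
      exact (hadj i).1 hi.symm
    · intro i j
      simp only [Function.Embedding.coeFn_mk]
      cases i using Fin.cases with
      | zero =>
        cases j using Fin.cases with
        | zero => simp
        | succ j => simpa using (hadj j).2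
      | succ i =>
        cases j using Fin.cases with
        | zero => simpa [G.adj_comm, K.adj_comm] using (hadj i).2
        | succ j => simp
    · intro i
      cases i using Fin.cases with
      | zero => simpa using hvX
      | succ i => simpa using (hf i).1

section

variable {α β : Type*} [Fintype α] [Fintype β]

/-- If `H[s]` and `K[t]` are disjoint unions of two pieces such that excluding any of the
four pieces (from `G` or from `Gᶜ`, respectively) makes a set easy to cover, then so does
excluding both `H[s]` from `G` and `K[t]` from `Gᶜ`. -/
theorem cover_of_freeOn_union {γ : Type*} (H : SimpleGraph α) (K : SimpleGraph β)
    {s₁ s₂ : Set α} {t₁ t₂ : Set β}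
    (hH : ∀ x ∈ s₁, ∀ y ∈ s₂, ¬ H.Adj x y) (hK : ∀ x ∈ t₁, ∀ y ∈ t₂, ¬ K.Adj x y)
    {G : SimpleGraph γ} {W : Set γ} {Ok : Set γ → Prop} (hOk : ∀ v, Ok {v}) {p : ℕ}
    (hs₁ : ∀ Y ⊆ W, H.FreeOn s₁ G Y → Cover Ok p Y)
    (hs₂ : ∀ Y ⊆ W, H.FreeOn s₂ G Y → Cover Ok p Y)
    (ht₁ : ∀ Y ⊆ W, K.FreeOn t₁ Gᶜ Y → Cover Ok p Y)
    (ht₂ : ∀ Y ⊆ W, K.FreeOn t₂ Gᶜ Y → Cover Ok p Y)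
    (hs : H.FreeOn (s₁ ∪ s₂) G W) (ht : K.FreeOn (t₁ ∪ t₂) Gᶜ W) :
    Cover Ok (embedThreshold (Fintype.card α + Fintype.card β) p (Fintype.card α)) W := by
  by_contra hW
  have hle : ∀ k (X : Set γ), ¬ Cover Ok ((Fintype.card α + Fintype.card β) * (k + 1) + p) X →
      ¬ Cover Ok (Fintype.card α * (k + 1) + p) X ∧
        ¬ Cover Ok (Fintype.card β * (k + 1) + p) X := by
    refine fun k X h => ⟨fun h' => h (h'.mono ?_ subset_rfl), fun h' => h (h'.mono ?_ subset_rfl)⟩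
    · gcongr; omega
    · gcongr; omega
  let e := Fintype.equivFin α
  obtain ⟨f, hf⟩ := exists_embedding_of_not_cover (G := G) (W := W) (Ok := Ok)
    (m := Fintype.card α + Fintype.card β) (p := p)
    (fun k X hX hc => hs₁ _ (Set.sep_subset _ _)
      (FreeOn.of_cover_inter_neighborSet hH hs hOk hs₂ hX (hle k X hc).1))
    (fun k X hX hc => ht₁ _ (Set.sep_subset _ _)
      (FreeOn.of_cover_inter_neighborSet hK ht hOk ht₂ hX (hle k X hc).2))
    _ (H.comap e.symm) (fun _ => W) (fun _ => subset_rfl) (fun _ => hW)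
  refine hs (f ∘ e) ⟨fun x _ => hf _, (f.injective.comp e.injective).injOn, fun x _ y _ => ?_⟩
  simp

/-- The parts allowed in the partition: subsingletons, and sets inducing no copy of some component
of `H` in `G` or of some component of `K` in `Gᶜ`. -/
def OkPart {γ : Type*} (H : SimpleGraph α) (K : SimpleGraph β) (G : SimpleGraph γ)
    (X : Set γ) : Prop :=
  X.Subsingleton ∨ (∃ c : H.ConnectedComponent, H.FreeOn c.supp G X) ∨
    ∃ c : K.ConnectedComponent, K.FreeOn c.supp Gᶜ X

theorem exists_cover_of_components (H : SimpleGraph α) (K : SimpleGraph β) (n : ℕ)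
    (s : Finset H.ConnectedComponent) (t : Finset K.ConnectedComponent)
    (hs : s.Nonempty) (ht : t.Nonempty) (hn : s.card + t.card ≤ n) :
    ∃ P : ℕ, ∀ (γ : Type) (G : SimpleGraph γ) (W : Set γ),
      H.FreeOn {x | H.connectedComponentMk x ∈ s} G W →
      K.FreeOn {x | K.connectedComponentMk x ∈ t} Gᶜ W → Cover (OkPart H K G) P W := by
  classical
  induction n generalizing s t with
  | zero => have := hs.card_pos; omega
  | succ n ih =>
    obtain ⟨c, hc⟩ := hs
    obtain ⟨d, hd⟩ := ht
    have hcc := Finset.card_erase_of_mem hc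
    have hdc := Finset.card_erase_of_mem hd
    have hcpos := Finset.card_pos.2 ⟨c, hc⟩
    have hdpos := Finset.card_pos.2 ⟨d, hd⟩
    have hseq : {x | H.connectedComponentMk x ∈ s} =
        c.supp ∪ {x | H.connectedComponentMk x ∈ s.erase c} := by
      conv_lhs => rw [← Finset.insert_erase hc]
      ext x; simp
    have hteq : {x | K.connectedComponentMk x ∈ t} =
        d.supp ∪ {x | K.connectedComponentMk x ∈ t.erase d} := by
      conv_lhs => rw [← Finset.insert_erase hd]
      ext x; simp
    rcases (s.erase c).eq_empty_or_nonempty with hs' | hs'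
    · refine ⟨1, fun γ G W hW _ => Cover.of_ok (Or.inr (Or.inl ⟨c, ?_⟩))⟩
      simpa [hseq, hs'] using hW
    rcases (t.erase d).eq_empty_or_nonempty with ht' | ht'
    · refine ⟨1, fun γ G W _ hW => Cover.of_ok (Or.inr (Or.inr ⟨d, ?_⟩))⟩
      simpa [hteq, ht'] using hW
    obtain ⟨p, hp⟩ := ih (s.erase c) t hs' ⟨d, hd⟩ (by omega)
    obtain ⟨q, hq⟩ := ih s (t.erase d) ⟨c, hc⟩ ht' (by omega)
    refine ⟨_, fun γ G W hsW htW => cover_of_freeOn_union H K (p := p + q + 1)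
      (s₁ := c.supp) (s₂ := {x | H.connectedComponentMk x ∈ s.erase c})
      (t₁ := d.supp) (t₂ := {x | K.connectedComponentMk x ∈ t.erase d})
      ?_ ?_ (fun v => Or.inl Set.subsingleton_singleton) ?_ ?_ ?_ ?_ (hseq ▸ hsW) (hteq ▸ htW)⟩
    · intro x hx y hy hxy
      rw [Set.mem_ofPred_eq, ← ConnectedComponent.connectedComponentMk_eq_of_adj hxy] at hy
      exact Finset.ne_of_mem_erase hy hx
    · intro x hx y hy hxy
      rw [Set.mem_ofPred_eq, ← ConnectedComponent.connectedComponentMk_eq_of_adj hxy] at hy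
      exact Finset.ne_of_mem_erase hy hx
    · exact fun Y _ hY => (Cover.of_ok (Or.inr (Or.inl ⟨c, hY⟩))).mono (by omega) subset_rfl
    · exact fun Y hYW hY => (hp γ G Y hY (htW.mono hYW)).mono (by omega) subset_rfl
    · exact fun Y _ hY => (Cover.of_ok (Or.inr (Or.inr ⟨d, hY⟩))).mono (by omega) subset_rfl
    · exact fun Y hYW hY => (hq γ G Y (hsW.mono hYW) hY).mono (by omega) subset_rfl

end

end SimpleGraph

theorem Contains.of_embedding {α β : Type} {G : SimpleGraph α} {H : SimpleGraph β}
    (f : H ↪g G) : Contains G H := by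
  refine ⟨Set.range f, ⟨SimpleGraph.Iso.symm ⟨Equiv.ofInjective f f.injective, ?_⟩⟩⟩
  intro a b
  simp

theorem free_induce_of_freeOn {α γ : Type} {H : SimpleGraph α} {s : Set α} {G : SimpleGraph γ}
    {W : Set γ} (hs : s.Nonempty) (h : H.FreeOn s G W) : Free (G.induce W) (H.induce s) := by
  classical
  rintro ⟨r, ⟨e⟩⟩
  obtain ⟨a, ha⟩ := hs
  let g : s → γ := fun x => (e.symm x : W)
  have hg : ∀ x, g x ∈ W := fun x => (e.symm x : W).2
  have hinj : Function.Injective g := fun x y hxy =>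
    e.symm.injective (Subtype.ext (Subtype.ext hxy))
  have hadj : ∀ x y, G.Adj (g x) (g y) ↔ H.Adj x y := fun x y =>
    e.symm.map_adj_iff (v := x) (w := y)
  refine h (fun x => if hx : x ∈ s then g ⟨x, hx⟩ else g ⟨a, ha⟩) ⟨?_, ?_, ?_⟩
  · intro x hx
    simpa [hx] using hg ⟨x, hx⟩
  · intro x hx y hy hxy
    simp only [hx, hy, dif_pos] at hxy
    exact congrArg Subtype.val (hinj hxy)
  · intro x hx y hy
    simpa [hx, hy] using hadj ⟨x, hx⟩ ⟨y, hy⟩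

theorem Free.freeOn_univ {α γ : Type} {H : SimpleGraph α} {G : SimpleGraph γ} (h : Free G H) :
    H.FreeOn Set.univ G Set.univ := fun f hf =>
  h (Contains.of_embedding ⟨⟨f, Set.injOn_univ.1 hf.2.1⟩, hf.2.2 _ trivial _ trivial⟩)

/-- For every pair of non-null graphs `(H,J)` there exists an integer `P > 0` such that
every `{H,J}`-free graph admits a `(c(H) ∪ ac(J), P)`-partition, where `c(H)` is the set
of components of `H` and `ac(J)` is the set of anticomponents of `J`. -/
theorem stmt2 {α β : Type} [Fintype α] [Fintype β] [Nonempty α] [Nonempty β]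
    (H : SimpleGraph α) (J : SimpleGraph β) :
    ∃ P : ℕ, 0 < P ∧
      ∀ (γ : Type) [Fintype γ] (G : SimpleGraph γ), Free G H → Free G J →
        HasPartition P (fun X : Set γ =>
          (∃ c : H.ConnectedComponent, Free (G.induce X) (H.induce c.supp)) ∨
          (∃ c : Jᶜ.ConnectedComponent, Free (G.induce X) (J.induce c.supp))) := by
  have : Fintype H.ConnectedComponent := Fintype.ofFinite _
  have : Fintype Jᶜ.ConnectedComponent := Fintype.ofFinite _
  have a : α := Classical.arbitrary α
  have b : β := Classical.arbitrary β
  obtain ⟨P, hP⟩ := H.exists_cover_of_components Jᶜ _ Finset.univ Finset.univ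
    ⟨H.connectedComponentMk a, Finset.mem_univ _⟩ ⟨Jᶜ.connectedComponentMk b, Finset.mem_univ _⟩
    le_rfl
  refine ⟨P + 1, P.succ_pos, fun γ _ G hGH hGJ => ?_⟩
  have hcov := hP γ G Set.univ (by simpa using hGH.freeOn_univ)
    (by simpa [SimpleGraph.freeOn_compl] using hGJ.freeOn_univ)
  refine (hcov.mono P.le_succ subset_rfl).hasPartition ?_ (Or.inl Set.subsingleton_empty) ?_
  · rintro S T hTS (h | ⟨c, h⟩ | ⟨c, h⟩)
    exacts [Or.inl (h.anti hTS), Or.inr (Or.inl ⟨c, h.mono hTS⟩), Or.inr (Or.inr ⟨c, h.mono hTS⟩)]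
  · rintro S (h | ⟨c, h⟩ | ⟨c, h⟩)
    · rcases h.eq_empty_or_singleton with rfl | h
      · exact Or.inr (Or.inl ⟨H.connectedComponentMk a,
          free_induce_of_freeOn (SimpleGraph.ConnectedComponent.nonempty_supp _)
            (SimpleGraph.FreeOn.empty (SimpleGraph.ConnectedComponent.nonempty_supp _))⟩)
      · exact Or.inl h
    · exact Or.inr (Or.inl ⟨c, free_induce_of_freeOn c.nonempty_supp h⟩)
    · exact Or.inr (Or.inr ⟨c, free_induce_of_freeOn c.nonempty_supp
        (SimpleGraph.freeOn_compl.1 h)⟩)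
end

section
/- Let k ≥ 1 be an integer, and let H and J be cographs, each of height k+1, such that H is anticonnected and J is connected. Then there exist cographs H̃ and J̃, each of height k, such that H̃ is connected, J̃ is anticonnected, and every {H,J}-free graph is {H̃, J̃}-split. -/
/-- `CographHeight G k` says that `G` is a cograph of height exactly `k`:
a one-vertex graph has height `0`; if `G` is not connected its height is one more than
the maximum height of its components; if `G` is not anticonnected its height is one more
than the maximum height of its anticomponents. -/
inductive CographHeight : ∀ {V : Type}, SimpleGraph V → ℕ → Prop
  | single {V : Type} (G : SimpleGraph V) (v : V) (hv : ∀ w, w = v) : CographHeight G 0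
  | union {V : Type} (G : SimpleGraph V) (k : ℕ) (h : ¬ G.Connected)
      (ht : G.ConnectedComponent → ℕ)
      (hc : ∀ c : G.ConnectedComponent, CographHeight (G.induce c.supp) (ht c))
      (hle : ∀ c, ht c ≤ k) (hmax : ∃ c, ht c = k) :
      CographHeight G (k + 1)
  | join {V : Type} (G : SimpleGraph V) (k : ℕ) (h : ¬ Gᶜ.Connected)
      (ht : Gᶜ.ConnectedComponent → ℕ)
      (hc : ∀ c : Gᶜ.ConnectedComponent, CographHeight (G.induce c.supp) (ht c))
      (hle : ∀ c, ht c ≤ k) (hmax : ∃ c, ht c = k) :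
      CographHeight G (k + 1)

/-- `G` is `{H₁,H₂}`-split if `V(G) = X₁ ∪ X₂` where `G|Xᵢ` is `Hᵢ`-free for `i = 1,2`. -/
def Split {γ α β : Type} (G : SimpleGraph γ) (H₁ : SimpleGraph α) (H₂ : SimpleGraph β) : Prop :=
  ∃ X₁ X₂ : Set γ, X₁ ∪ X₂ = Set.univ ∧ Free (G.induce X₁) H₁ ∧ Free (G.induce X₂) H₂

/-- The total weight that `w` assigns to the set `A`. -/
noncomputable def wt {Ω : Type} [Fintype Ω] (w : Ω → ℝ) (A : Set Ω) : ℝ :=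
  ∑ u, A.indicator w u

section Weight

variable {Ω : Type} [Fintype Ω] {w : Ω → ℝ}

theorem wt_univ : wt w Set.univ = ∑ u, w u := by simp [wt]

theorem wt_mono (hw : ∀ u, 0 ≤ w u) {A B : Set Ω} (h : A ⊆ B) : wt w A ≤ wt w B :=
  Finset.sum_le_sum fun u _ => Set.indicator_le_indicator_of_subset h hw u

theorem wt_union_le (hw : ∀ u, 0 ≤ w u) (A B : Set Ω) : wt w (A ∪ B) ≤ wt w A + wt w B := by
  classical
  unfold wt
  rw [← Finset.sum_add_distrib]
  refine Finset.sum_le_sum fun u _ => ?_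
  have := hw u
  by_cases hA : u ∈ A <;> by_cases hB : u ∈ B <;> simp [hA, hB, this]

theorem wt_biUnion_le (hw : ∀ u, 0 ≤ w u) {ι : Type} (s : Finset ι) (A : ι → Set Ω) :
    wt w (⋃ i ∈ s, A i) ≤ ∑ i ∈ s, wt w (A i) := by
  classical
  induction s using Finset.induction_on with
  | empty => simp [wt]
  | insert i s hi ih =>
    rw [Finset.sum_insert hi, Finset.set_biUnion_insert]
    exact (wt_union_le hw _ _).trans (by gcongr)

theorem nonempty_of_wt_pos {A : Set Ω} (h : 0 < wt w A) : A.Nonempty := by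
  rw [Set.nonempty_iff_ne_empty]
  rintro rfl
  simp [wt] at h

/-- Among many events of weight at least `δ`, some `n` have an intersection of weight bounded
below. -/
theorem exists_wt_iInter_ge (hw : ∀ u, 0 ≤ w u) (hw1 : ∑ u, w u ≤ 1) {n M : ℕ} {δ : ℝ}
    (hM : n + 1 ≤ M * δ) (E : Fin M → Set Ω) (hE : ∀ i, δ ≤ wt w (E i)) :
    ∃ g : Fin n ↪ Fin M, 1 / (M * 2 ^ M : ℝ) ≤ wt w (⋂ j, E (g j)) := by
  classical
  have hMpos : (0 : ℝ) < M := by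
    rcases Nat.eq_zero_or_pos M with rfl | h
    · simp at hM; linarith [(Nat.cast_nonneg n : (0 : ℝ) ≤ n)]
    · exact_mod_cast h
  let N : Ω → Finset (Fin M) := fun u => Finset.univ.filter fun i => u ∈ E i
  let B : Set Ω := {u | n ≤ (N u).card}
  have hsum : (M : ℝ) * δ ≤ n + M * wt w B := by
    calc (M : ℝ) * δ = ∑ _i : Fin M, δ := by simp
      _ ≤ ∑ i, wt w (E i) := Finset.sum_le_sum fun i _ => hE i
      _ = ∑ u, ((N u).card : ℝ) * w u := by
        unfold wt
        rw [Finset.sum_comm]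
        refine Finset.sum_congr rfl fun u _ => ?_
        simp [N, Set.indicator_apply, Finset.sum_ite]
      _ ≤ ∑ u, (n * w u + M * B.indicator w u) := by
        refine Finset.sum_le_sum fun u _ => ?_
        have h0 := hw u
        by_cases hu : u ∈ B
        · have : ((N u).card : ℝ) ≤ M := by
            exact_mod_cast (Finset.card_le_univ (N u)).trans (by simp)
          simp only [Set.indicator_of_mem hu]
          have := mul_le_mul_of_nonneg_right this h0
          have : 0 ≤ (n : ℝ) * w u := by positivity
          linarith
        · have : ((N u).card : ℝ) ≤ n := by
            have : ¬ n ≤ (N u).card := hu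
            exact_mod_cast (not_le.mp this).le
          simp only [Set.indicator_of_notMem hu]
          have := mul_le_mul_of_nonneg_right this h0
          linarith
      _ = n * ∑ u, w u + M * wt w B := by
        rw [Finset.sum_add_distrib, ← Finset.mul_sum, ← Finset.mul_sum]; rfl
      _ ≤ n + M * wt w B := by
        have := mul_le_mul_of_nonneg_left hw1 (Nat.cast_nonneg n : (0 : ℝ) ≤ n)
        linarith
  have hB : 1 / (M : ℝ) ≤ wt w B := by
    rw [div_le_iff₀ hMpos]; linarith
  by_contra! hcon
  have hsub : B ⊆ ⋃ g ∈ (Finset.univ : Finset (Finset (Fin M))).filter (fun I => I.card = n),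
      ⋂ i ∈ g, E i := by
    intro u hu
    obtain ⟨I, hI, hIn⟩ := Finset.exists_subset_card_eq (show n ≤ (N u).card from hu)
    simp only [Set.mem_iUnion, Set.mem_iInter]
    refine ⟨I, by simpa using hIn, fun i hi => ?_⟩
    simpa [N] using hI hi
  have h1 := (wt_mono hw hsub).trans (wt_biUnion_le hw _ _)
  have hlt : ∀ I ∈ (Finset.univ : Finset (Finset (Fin M))).filter (fun I => I.card = n),
      wt w (⋂ i ∈ I, E i) < 1 / (M * 2 ^ M : ℝ) := by
    intro I hI
    have hIn : I.card = n := by simpa using hI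
    refine lt_of_le_of_lt (wt_mono hw ?_) (hcon (I.orderEmbOfFin hIn).toEmbedding)
    intro u hu
    simp only [Set.mem_iInter] at hu ⊢
    exact fun j => hu _ (Finset.orderEmbOfFin_mem I hIn j)
  rcases Finset.eq_empty_or_nonempty
    ((Finset.univ : Finset (Finset (Fin M))).filter (fun I => I.card = n)) with he | hne
  · rw [he, Finset.sum_empty] at h1
    have : 0 < 1 / (M : ℝ) := by positivity
    linarith
  · have h2 := Finset.sum_lt_sum_of_nonempty hne hlt
    rw [Finset.sum_const, nsmul_eq_mul] at h2
    have hc : ((((Finset.univ : Finset (Finset (Fin M))).filter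
        (fun I => I.card = n)).card : ℕ) : ℝ) ≤ 2 ^ M := by
      have := Finset.card_filter_le (Finset.univ : Finset (Finset (Fin M))) (fun I => I.card = n)
      rw [Finset.card_univ, Fintype.card_finset, Fintype.card_fin] at this
      exact_mod_cast this
    have h3 := mul_le_mul_of_nonneg_right hc (show (0 : ℝ) ≤ 1 / (M * 2 ^ M) by positivity)
    have h4 : (2 : ℝ) ^ M * (1 / (M * 2 ^ M)) = 1 / M := by field_simp
    linarith

end Weight

/-- The finite minimax theorem for incidence of elements in sets, as an alternative. -/
theorem exists_weight_or_fractional_cover {I J : Type} [Fintype I] [Fintype J] [Nonempty J]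
    (F : J → Set I) (ε : ℝ) :
    (∃ μ : I → ℝ, (∀ i, 0 ≤ μ i) ∧ ∑ i, μ i = 1 ∧ ∀ j, wt μ (F j) ≤ ε) ∨
    ∃ ν : J → ℝ, (∀ j, 0 ≤ ν j) ∧ ∑ j, ν j = 1 ∧ ∀ i, ε ≤ wt ν {j | i ∈ F j} := by
  classical
  obtain ⟨j₀⟩ := ‹Nonempty J›
  rcases isEmpty_or_nonempty I with hI | ⟨⟨i₀⟩⟩
  · have h := single_mem_stdSimplex ℝ j₀
    exact Or.inr ⟨Pi.single j₀ 1, h.1, h.2, fun i => hI.elim i⟩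
  let f : (I → ℝ) → (J → ℝ) → ℝ := fun μ ν => ∑ i, ∑ j, (F j).indicator (fun _ => μ i * ν j) i
  have hc : ∀ (i : I) (j : J) (a : ℝ),
      (F j).indicator (fun _ => a) i = (if i ∈ F j then 1 else 0) * a := by
    intro i j a; simp [Set.indicator_apply]
  have hlin1 : ∀ ν, IsLinearMap ℝ fun μ => f μ ν := by
    intro ν
    constructor
    · intro x y
      simp only [f, hc, Pi.add_apply, ← Finset.sum_add_distrib]
      exact Finset.sum_congr rfl fun _ _ => Finset.sum_congr rfl fun _ _ => by ring
    · intro c x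
      simp only [f, hc, Pi.smul_apply, smul_eq_mul, Finset.mul_sum]
      exact Finset.sum_congr rfl fun _ _ => Finset.sum_congr rfl fun _ _ => by ring
  have hlin2 : ∀ μ, IsLinearMap ℝ fun ν => f μ ν := by
    intro ν
    constructor
    · intro x y
      simp only [f, hc, Pi.add_apply, ← Finset.sum_add_distrib]
      exact Finset.sum_congr rfl fun _ _ => Finset.sum_congr rfl fun _ _ => by ring
    · intro c x
      simp only [f, hc, Pi.smul_apply, smul_eq_mul, Finset.mul_sum]
      exact Finset.sum_congr rfl fun _ _ => Finset.sum_congr rfl fun _ _ => by ring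
  have hcont1 : ∀ ν, Continuous fun μ => f μ ν := by
    intro ν; simp only [f, hc]; fun_prop
  have hcont2 : ∀ μ, Continuous fun ν => f μ ν := by
    intro ν; simp only [f, hc]; fun_prop
  obtain ⟨μ, hμ, ν, hν, h⟩ := Sion.exists_isSaddlePointOn (X := stdSimplex ℝ I)
    (Y := stdSimplex ℝ J) (f := f)
    ⟨_, single_mem_stdSimplex ℝ i₀⟩ (convex_stdSimplex ℝ I) (isCompact_stdSimplex ℝ I)
    (fun ν _ => (hcont1 ν).lowerSemicontinuous.lowerSemicontinuousOn _)
    (fun ν _ => ((hlin1 ν).mk' _ |>.convexOn (convex_stdSimplex ℝ I)).quasiconvexOn)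
    (convex_stdSimplex ℝ J) ⟨_, single_mem_stdSimplex ℝ j₀⟩ (isCompact_stdSimplex ℝ J)
    (fun μ _ => (hcont2 μ).upperSemicontinuous.upperSemicontinuousOn _)
    (fun μ _ => ((hlin2 μ).mk' _ |>.concaveOn (convex_stdSimplex ℝ J)).quasiconcaveOn)
  have e1 : ∀ j, f μ (Pi.single j 1) = wt μ (F j) := by
    intro j
    simp only [f, hc, wt]
    refine Finset.sum_congr rfl fun i _ => ?_
    rw [Finset.sum_eq_single j]
    · simp [Set.indicator_apply]
    · intro b _ hb; simp [hb]
    · simp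
  have e2 : ∀ i, f (Pi.single i 1) ν = wt ν {j | i ∈ F j} := by
    intro i
    simp only [f, hc, wt]
    rw [Finset.sum_eq_single i]
    · simp [Set.indicator_apply]
    · intro b _ hb; simp [hb]
    · simp
  by_cases hε : f μ ν ≤ ε
  · exact Or.inl ⟨μ, hμ.1, hμ.2, fun j => by
      rw [← e1]; exact (h μ hμ _ (single_mem_stdSimplex ℝ j)).trans hε⟩
  · exact Or.inr ⟨ν, hν.1, hν.2, fun i => by
      rw [← e2]; exact (not_le.mp hε).le.trans (h _ (single_mem_stdSimplex ℝ i) ν hν)⟩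

section Trees

variable {V : Type}

/-- Distinct vertices that are adjacent (`c = true`) or nonadjacent (`c = false`). -/
def AdjAs (G : SimpleGraph V) (c : Bool) (x y : V) : Prop :=
  x ≠ y ∧ (G.Adj x y ↔ c = true)

theorem AdjAs.symm {G : SimpleGraph V} {c : Bool} {x y : V} (h : AdjAs G c x y) : AdjAs G c y x :=
  ⟨h.1.symm, by rw [G.adj_comm]; exact h.2⟩

/-- `S` includes `m` sets satisfying `P` which are pairwise complete (`c = true`) or pairwise
anticomplete (`c = false`). -/
def Many (G : SimpleGraph V) (c : Bool) (m : ℕ) (P : Set V → Prop) (S : Set V) : Prop :=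
  ∃ f : Fin m → Set V, (∀ i, f i ⊆ S) ∧ (∀ i, P (f i)) ∧
    ∀ i j, i ≠ j → ∀ x ∈ f i, ∀ y ∈ f j, AdjAs G c x y

theorem Many.mono {G : SimpleGraph V} {c : Bool} {m m' : ℕ} {P P' : Set V → Prop} {S S' : Set V}
    (h : Many G c m P S) (hm : m' ≤ m) (hP : ∀ T, P T → P' T) (hS : S ⊆ S') :
    Many G c m' P' S' := by
  obtain ⟨f, h1, h2, h3⟩ := h
  exact ⟨fun i => f (Fin.castLE hm i), fun i => (h1 _).trans hS, fun i => hP _ (h2 _),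
    fun i j hij => h3 _ _ fun h => hij (Fin.castLE_injective hm h)⟩

/-- `S` includes a copy of the cograph whose cotree is the complete `n`-ary tree of depth `k`,
the root being a join (`c = true`) or a disjoint union (`c = false`). -/
def Has (G : SimpleGraph V) (n : ℕ) : Bool → ℕ → Set V → Prop
  | _, 0 => Set.Nonempty
  | c, k + 1 => Many G c n (Has G n (!c) k)

theorem Has.mono {G : SimpleGraph V} {n m : ℕ} (hm : m ≤ n) {k : ℕ} :
    ∀ {c : Bool} {S T : Set V}, Has G n c k S → S ⊆ T → Has G m c k T := by
  induction k with
  | zero => exact fun h hST => Set.Nonempty.mono hST h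
  | succ k ih => exact fun h hST => Many.mono h hm (fun T hT => ih hT subset_rfl) hST

theorem Has.nonempty {G : SimpleGraph V} {n : ℕ} (hn : 0 < n) {k : ℕ} :
    ∀ {c : Bool} {S : Set V}, Has G n c k S → S.Nonempty := by
  induction k with
  | zero => exact fun h => h
  | succ k ih => exact fun ⟨f, h1, h2, _⟩ => (ih (h2 ⟨0, hn⟩)).mono (h1 _)

/-- A weighted Ramsey property: if every vertex of a large enough tree is in a random set with
probability at least `δ`, then some subtree is included in it with probability bounded below. -/
theorem exists_has_subset_wt_ge (n k : ℕ) {δ : ℝ} (hδ : 0 < δ) :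
    ∃ (M : ℕ) (δ' : ℝ), 0 < δ' ∧ ∀ (V Ω : Type) [Fintype Ω] (G : SimpleGraph V) (w : Ω → ℝ)
      (T : V → Set Ω) (c : Bool) (X : Set V), (∀ u, 0 ≤ w u) → ∑ u, w u ≤ 1 → Has G M c k X →
      (∀ x ∈ X, δ ≤ wt w (T x)) →
      ∃ Y ⊆ X, Has G n c k Y ∧ δ' ≤ wt w (⋂ x ∈ Y, T x) := by
  induction k with
  | zero =>
    refine ⟨0, δ, hδ, fun V Ω _ G w T c X hw hw1 hX hT => ?_⟩
    obtain ⟨x, hx⟩ : X.Nonempty := hX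
    exact ⟨{x}, by simpa using hx, Set.singleton_nonempty x, by simpa using hT x hx⟩
  | succ k ih =>
    obtain ⟨M₀, δ₀, hδ₀, h⟩ := ih
    obtain ⟨M₁, hM₁⟩ := exists_nat_ge ((n + 1) / δ₀)
    rw [div_le_iff₀ hδ₀] at hM₁
    have hM₁pos : 0 < M₁ := by
      rcases Nat.eq_zero_or_pos M₁ with rfl | h
      · simp at hM₁; linarith [(Nat.cast_nonneg n : (0 : ℝ) ≤ n)]
      · exact h
    refine ⟨max M₀ M₁, 1 / (M₁ * 2 ^ M₁), by positivity,
      fun V Ω _ G w T c X hw hw1 hX hT => ?_⟩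
    obtain ⟨f, hf1, hf2, hf3⟩ : Many G c M₁ (Has G M₀ (!c) k) X :=
      Many.mono hX (le_max_right _ _) (fun S hS => hS.mono (le_max_left _ _) subset_rfl) subset_rfl
    choose Y hYf hY hYw using fun i => h V Ω G w T (!c) (f i) hw hw1 (hf2 i)
      (fun x hx => hT x (hf1 i hx))
    obtain ⟨g, hg⟩ := exists_wt_iInter_ge hw hw1 hM₁ _ hYw
    refine ⟨⋃ j, Y (g j), Set.iUnion_subset fun j => (hYf _).trans (hf1 _),
      ⟨fun j => Y (g j), Set.subset_iUnion fun j => Y (g j), fun j => hY _,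
        fun i j hij x hx y hy => hf3 _ _ (fun h => hij (g.injective h)) _ (hYf _ hx) _ (hYf _ hy)⟩,
      hg.trans (wt_mono hw ?_)⟩
    intro u hu
    simp only [Set.mem_iInter, Set.mem_iUnion] at hu ⊢
    rintro x ⟨j, hx⟩
    exact hu j x hx

/-- `S` is the union of a set without large join-rooted trees and a set without large
union-rooted trees. -/
def TreeSplit (G : SimpleGraph V) (L k : ℕ) (S : Set V) : Prop :=
  ∃ X : Bool → Set V, S ⊆ X true ∪ X false ∧ ∀ c, ¬ Has G L c k (X c)

theorem TreeSplit.mono {G : SimpleGraph V} {L L' k : ℕ} (h : L ≤ L') {S : Set V}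
    (hS : TreeSplit G L k S) : TreeSplit G L' k S := by
  obtain ⟨X, h1, h2⟩ := hS
  exact ⟨X, h1, fun c hc => h2 c (hc.mono h subset_rfl)⟩

/-- If `μ` is a measure on `S` giving small measure to every set without large trees, then the
vertices joined in manner `!c` to a large part of `S` do not include a large tree rooted
in manner `c`. -/
theorem not_has_of_wt_le {n k L M a : ℕ} {δ' ε : ℝ} (hε : 2 * ε < δ') (c : Bool)
    (hM : ∀ (V Ω : Type) [Fintype Ω] (G : SimpleGraph V) (w : Ω → ℝ)
      (T : V → Set Ω) (c : Bool) (X : Set V), (∀ u, 0 ≤ w u) → ∑ u, w u ≤ 1 → Has G M c k X →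
      (∀ x ∈ X, 1 / 3 ≤ wt w (T x)) →
      ∃ Y ⊆ X, Has G n c k Y ∧ δ' ≤ wt w (⋂ x ∈ Y, T x))
    (G : SimpleGraph V) (S : Set V) [Fintype S] (μ : S → ℝ) (hμ : ∀ u, 0 ≤ μ u)
    (hμ1 : ∑ u, μ u = 1)
    (hgood : ∀ (d : Bool) (F : Set V), ¬ Has G L d k F → wt μ {u | u.1 ∈ F} ≤ ε)
    (hS : ¬ Many G (!c) (a + 1) (Has G n c k) S)
    (hind : ∀ U ⊆ S, ¬ Many G (!c) a (Has G n c k) U → TreeSplit G L k U) :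
    ¬ Has G M c k {x | x ∈ S ∧ 1 / 3 ≤ wt μ {u | AdjAs G (!c) u.1 x}} := by
  intro hX
  obtain ⟨Y, hYX, hY, hYw⟩ := hM V S G μ (fun x => {u | AdjAs G (!c) u.1 x}) c _ hμ hμ1.le hX
    (fun x hx => hx.2)
  let U : Set V := {u | u ∈ S ∧ ∀ x ∈ Y, AdjAs G (!c) u x}
  obtain ⟨Z, hZ, hZL⟩ := hind U (fun u hu => hu.1) <| by
    rintro ⟨f, hf1, hf2, hf3⟩
    refine hS ⟨Fin.cons Y f, fun i => ?_, fun i => ?_, fun i j hij => ?_⟩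
    · refine Fin.cases ?_ (fun i => ?_) i
      · exact fun x hx => (hYX hx).1
      · exact fun x hx => (hf1 i hx).1
    · refine Fin.cases ?_ (fun i => ?_) i
      · exact hY
      · exact hf2 i
    · revert hij
      refine Fin.cases ?_ (fun i => ?_) i <;> refine Fin.cases ?_ (fun j => ?_) j
      · exact fun h => absurd rfl h
      · exact fun _ x hx y hy => ((hf1 j hy).2 x hx).symm
      · exact fun _ x hx y hy => (hf1 i hx).2 y hy
      · exact fun h => hf3 i j fun h' => h (congrArg _ h')
  have h1 : wt μ (⋂ x ∈ Y, {u : S | AdjAs G (!c) u.1 x}) ≤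
      wt μ ({u : S | u.1 ∈ Z true} ∪ {u : S | u.1 ∈ Z false}) := by
    refine wt_mono hμ fun u hu => ?_
    simp only [Set.mem_iInter] at hu
    exact hZ ⟨u.2, hu⟩
  have h2 := wt_union_le hμ {u : S | u.1 ∈ Z true} {u : S | u.1 ∈ Z false}
  have h3 := hgood true _ (hZL true)
  have h4 := hgood false _ (hZL false)
  linarith

/-- A random set without large trees, containing each vertex of `X` with probability bounded
below, shows that `X` has no very large tree. -/
theorem not_has_of_fractional_cover {n k M : ℕ} {δ δ' : ℝ} (hn : 0 < n) (hδ' : 0 < δ') (c : Bool)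
    (hM : ∀ (V Ω : Type) [Fintype Ω] (G : SimpleGraph V) (w : Ω → ℝ)
      (T : V → Set Ω) (c : Bool) (X : Set V), (∀ u, 0 ≤ w u) → ∑ u, w u ≤ 1 → Has G M c k X →
      (∀ x ∈ X, δ ≤ wt w (T x)) →
      ∃ Y ⊆ X, Has G n c k Y ∧ δ' ≤ wt w (⋂ x ∈ Y, T x))
    (G : SimpleGraph V) {J : Type} [Fintype J] (F : J → Set V) (ν : J → ℝ) (hν : ∀ j, 0 ≤ ν j)
    (hν1 : ∑ j, ν j = 1) :
    ¬ Has G M c k {x | δ ≤ wt ν {j | x ∈ F j ∧ ¬ Has G n c k (F j)}} := by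
  intro hX
  obtain ⟨Y, hYX, hY, hYw⟩ := hM V J G ν (fun x => {j | x ∈ F j ∧ ¬ Has G n c k (F j)}) c _
    hν hν1.le hX (fun x hx => hx)
  obtain ⟨j, hj⟩ := nonempty_of_wt_pos (hδ'.trans_le hYw)
  simp only [Set.mem_iInter] at hj
  obtain ⟨x, hx⟩ := hY.nonempty hn
  exact (hj x hx).2 (hY.mono le_rfl fun x hx => (hj x hx).1)

theorem not_has_singleton {G : SimpleGraph V} {n k : ℕ} (hn : 2 ≤ n) (hk : 1 ≤ k) (c : Bool)
    (v : V) : ¬ Has G n c k {v} := by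
  obtain ⟨k, rfl⟩ := Nat.exists_eq_add_of_le' hk
  rintro ⟨f, h1, h2, h3⟩
  obtain ⟨x, hx⟩ := (h2 ⟨0, by omega⟩).nonempty (by omega)
  obtain ⟨y, hy⟩ := (h2 ⟨1, by omega⟩).nonempty (by omega)
  refine (h3 ⟨0, by omega⟩ ⟨1, by omega⟩ (by simp) x hx y hy).1 ?_
  exact (h1 _ hx).trans (h1 _ hy).symm

theorem exists_treeSplit_step {n k L a b : ℕ} (hk : 1 ≤ k) (hL : 2 ≤ L)
    (ha : ∀ (V : Type) [Fintype V] (G : SimpleGraph V) (S : Set V),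
      ¬ Many G false a (Has G n true k) S → ¬ Many G true (b + 1) (Has G n false k) S →
        TreeSplit G L k S)
    (hb : ∀ (V : Type) [Fintype V] (G : SimpleGraph V) (S : Set V),
      ¬ Many G false (a + 1) (Has G n true k) S → ¬ Many G true b (Has G n false k) S →
        TreeSplit G L k S) :
    ∃ L', ∀ (V : Type) [Fintype V] (G : SimpleGraph V) (S : Set V),
      ¬ Many G false (a + 1) (Has G n true k) S → ¬ Many G true (b + 1) (Has G n false k) S →
        TreeSplit G L' k S := by
  classical
  obtain ⟨M₁, δ₁, hδ₁, hM₁⟩ := exists_has_subset_wt_ge n k (δ := 1 / 3) (by norm_num)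
  obtain ⟨ε, hε, hε1, hε2⟩ : ∃ ε : ℝ, 0 < ε ∧ 2 * ε < δ₁ ∧ ε < 1 / 3 :=
    ⟨min (δ₁ / 3) (1 / 4), by positivity, by
      linarith [min_le_left (δ₁ / 3) (1 / 4)], by linarith [min_le_right (δ₁ / 3) (1 / 4)]⟩
  obtain ⟨M₂, δ₂, hδ₂, hM₂⟩ := exists_has_subset_wt_ge L k (δ := ε / 2) (by positivity)
  refine ⟨max M₁ M₂, fun V _ G S hS1 hS2 => ?_⟩
  let J := {F : Set V // ∃ d, ¬ Has G L d k F}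
  have : Nonempty J :=
    ⟨⟨∅, true, fun h => Set.not_nonempty_empty (h.nonempty (by omega))⟩⟩
  rcases exists_weight_or_fractional_cover (I := S) (J := J) (fun j => {u | u.1 ∈ j.1}) ε with
    ⟨μ, hμ, hμ1, hμF⟩ | ⟨ν, hν, hν1, hνF⟩
  · have hgood : ∀ (d : Bool) (F : Set V), ¬ Has G L d k F → wt μ {u | u.1 ∈ F} ≤ ε :=
      fun d F hF => hμF ⟨F, d, hF⟩
    refine TreeSplit.mono (le_max_left _ _)
      ⟨fun c => {x | x ∈ S ∧ 1 / 3 ≤ wt μ {u | AdjAs G (!c) u.1 x}}, fun x hx => ?_, fun c => ?_⟩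
    · by_contra! hcon
      simp only [Set.mem_union, Set.mem_ofPred_eq, hx, true_and, not_or, not_le] at hcon
      have h1 : wt μ Set.univ ≤ wt μ ({u | AdjAs G (!true) u.1 x} ∪
          {u | AdjAs G (!false) u.1 x} ∪ {u | u.1 ∈ ({x} : Set V)}) := by
        refine wt_mono hμ fun u _ => ?_
        simp only [Set.mem_union, Set.mem_ofPred_eq, AdjAs, Set.mem_singleton_iff]
        by_cases h : u.1 = x <;> by_cases h' : G.Adj u.1 x <;> simp [h, h']
      rw [wt_univ, hμ1] at h1
      have h2 := wt_union_le hμ ({u : S | AdjAs G (!true) u.1 x} ∪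
          {u | AdjAs G (!false) u.1 x}) {u | u.1 ∈ ({x} : Set V)}
      have h3 := wt_union_le hμ {u : S | AdjAs G (!true) u.1 x} {u | AdjAs G (!false) u.1 x}
      have h4 := hgood true {x} (not_has_singleton hL hk _ _)
      linarith
    · refine not_has_of_wt_le (a := if c then a else b) hε1 c hM₁ G S μ hμ hμ1 hgood ?_ ?_
      · cases c <;> simpa
      · intro U hU hUm
        cases c
        · exact hb V G U (fun h => hS1 (h.mono le_rfl (fun _ h => h) hU)) (by simpa using hUm)
        · exact ha V G U (by simpa using hUm) (fun h => hS2 (h.mono le_rfl (fun _ h => h) hU))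
  · refine TreeSplit.mono (le_max_right _ _)
      ⟨fun c => {x | ε / 2 ≤ wt ν {j | x ∈ j.1 ∧ ¬ Has G L c k j.1}}, fun x hx => ?_, fun c =>
        not_has_of_fractional_cover (by omega) hδ₂ c hM₂ G (fun j : J => j.1) ν hν hν1⟩
    by_contra! hcon
    simp only [Set.mem_union, Set.mem_ofPred_eq, not_or, not_le] at hcon
    have h1 := hνF ⟨x, hx⟩
    have h2 : wt ν {j : J | x ∈ j.1} ≤ wt ν ({j | x ∈ j.1 ∧ ¬ Has G L true k j.1} ∪
        {j | x ∈ j.1 ∧ ¬ Has G L false k j.1}) := by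
      refine wt_mono hν fun j hj => ?_
      obtain ⟨d, hd⟩ := j.2
      cases d
      · exact Or.inr ⟨hj, hd⟩
      · exact Or.inl ⟨hj, hd⟩
    have h3 := wt_union_le hν {j : J | x ∈ j.1 ∧ ¬ Has G L true k j.1}
        {j | x ∈ j.1 ∧ ¬ Has G L false k j.1}
    simp only [Set.mem_ofPred_eq] at h1
    linarith

/-- Graphs without `a` pairwise anticomplete join-rooted trees and without `b` pairwise complete
union-rooted trees are split. -/
theorem exists_treeSplit (n : ℕ) {k : ℕ} (hk : 1 ≤ k) (a b : ℕ) :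
    ∃ L, ∀ (V : Type) [Fintype V] (G : SimpleGraph V) (S : Set V),
      ¬ Many G false a (Has G n true k) S → ¬ Many G true b (Has G n false k) S →
        TreeSplit G L k S := by
  induction a generalizing b with
  | zero => exact ⟨0, fun V _ G S h => absurd ⟨Fin.elim0, by simp⟩ h⟩
  | succ a iha =>
    induction b with
    | zero => exact ⟨0, fun V _ G S _ h => absurd ⟨Fin.elim0, by simp⟩ h⟩
    | succ b ihb =>
      obtain ⟨L₁, h1⟩ := iha (b + 1)
      obtain ⟨L₂, h2⟩ := ihb
      exact exists_treeSplit_step hk (L := max 2 (max L₁ L₂)) (le_max_left _ _)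
        (fun V _ G S ha hb => (h1 V G S ha hb).mono (by simp))
        (fun V _ G S ha hb => (h2 V G S ha hb).mono (by simp))

end Trees

section Cographs

theorem induce_compl_eq {α : Type} (H : SimpleGraph α) (s : Set α) :
    (H.induce s)ᶜ = Hᶜ.induce s := by
  ext x y
  simp [Subtype.ext_iff]

theorem exists_embedding_of_components {α V : Type} [Finite α] {n : ℕ} (hn : Nat.card α ≤ n)
    {H K : SimpleGraph α} {G : SimpleGraph V} {c : Bool}
    (hK : ∀ x y, K.connectedComponentMk x ≠ K.connectedComponentMk y → (H.Adj x y ↔ c = true))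
    {f : Fin n → Set V} (hf : ∀ i j, i ≠ j → ∀ x ∈ f i, ∀ y ∈ f j, AdjAs G c x y)
    (he : ∀ (C : K.ConnectedComponent) (i : Fin n),
      ∃ e : H.induce C.supp ↪g G, ∀ v, e v ∈ f i) :
    ∃ e : H ↪g G, ∀ v, ∃ i, e v ∈ f i := by
  obtain ⟨g⟩ : Nonempty (K.ConnectedComponent ↪ Fin n) := by
    have : Finite K.ConnectedComponent := Quot.finite _
    have := Fintype.ofFinite K.ConnectedComponent
    refine Function.Embedding.nonempty_of_card_le ?_
    rw [Fintype.card_fin, ← Nat.card_eq_fintype_card]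
    exact (Nat.card_le_card_of_surjective _ Quot.mk_surjective).trans hn
  choose e he using he
  let E : α → V := fun v => e (K.connectedComponentMk v) (g (K.connectedComponentMk v)) ⟨v, rfl⟩
  have hE : ∀ v C (h : K.connectedComponentMk v = C), E v = e C (g C) ⟨v, h⟩ := by
    rintro v _ rfl; rfl
  have hne : ∀ v w, K.connectedComponentMk v ≠ K.connectedComponentMk w →
      AdjAs G c (E v) (E w) := fun v w h =>
    hf _ _ (fun h' => h (g.injective h')) _ (he _ _ _) _ (he _ _ _)
  refine ⟨⟨⟨E, fun v w hvw => ?_⟩, fun {v w} => ?_⟩, fun v => ⟨_, he _ _ _⟩⟩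
  · by_cases h : K.connectedComponentMk v = K.connectedComponentMk w
    · rw [hE v _ h, hE w _ rfl] at hvw
      exact congrArg Subtype.val ((e _ _).injective hvw)
    · exact absurd hvw (hne v w h).1
  · change G.Adj (E v) (E w) ↔ H.Adj v w
    by_cases h : K.connectedComponentMk v = K.connectedComponentMk w
    · rw [hE v _ h, hE w _ rfl, SimpleGraph.Embedding.map_adj_iff]
      rfl
    · rw [(hne v w h).2, hK v w h]

/-- The graph `H` if `c = true`, and its complement if `c = false`. -/
def twist {α : Type} (c : Bool) (H : SimpleGraph α) : SimpleGraph α := if c then H else Hᶜ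

theorem exists_embedding_of_has_of_components {α V : Type} [Finite α] {n : ℕ}
    (hn : Nat.card α ≤ n) {H K : SimpleGraph α} {c : Bool} (hHK : K = twist (!c) H)
    (hcon : ¬ K.Connected) {h : ℕ} {ht : K.ConnectedComponent → ℕ} (hle : ∀ C, ht C ≤ h)
    (hmax : ∃ C, ht C = h) {G : SimpleGraph V}
    (ih : ∀ (C : K.ConnectedComponent) (k : ℕ) (d : Bool) (S : Set V), Has G n d k S →
      (ht C < k ∨ ht C = k ∧ (twist d (H.induce C.supp)).Connected) →
      ∃ e : H.induce C.supp ↪g G, ∀ v, e v ∈ S)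
    {k : ℕ} {d : Bool} {S : Set V} (hS : Has G n d k S)
    (hk : h + 1 < k ∨ h + 1 = k ∧ (twist d H).Connected) :
    ∃ e : H ↪g G, ∀ v, e v ∈ S := by
  have hK : ∀ x y, K.connectedComponentMk x ≠ K.connectedComponentMk y →
      (H.Adj x y ↔ c = true) := by
    intro x y hxy
    have hadj : ¬ K.Adj x y := fun h => hxy (SimpleGraph.ConnectedComponent.sound h.reachable)
    have hne : x ≠ y := fun h => hxy (congrArg _ h)
    subst hHK
    cases c <;> simpa [twist, hne] using hadj
  have hC : ∀ s : Set α, twist (!c) (H.induce s) = K.induce s := by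
    intro s
    rw [hHK]
    cases c
    · rfl
    · exact induce_compl_eq _ _
  have key : ∀ k S, Has G n c k S → h + 1 ≤ k → ∃ e : H ↪g G, ∀ v, e v ∈ S := by
    intro k S hS hk
    obtain ⟨k, rfl⟩ := Nat.exists_eq_add_of_le' (show 1 ≤ k by omega)
    obtain ⟨f, hf1, hf2, hf3⟩ := hS
    obtain ⟨e, he⟩ := exists_embedding_of_components hn hK hf3 fun C i =>
      ih C k (!c) (f i) (hf2 i) <| by
        have := hle C
        refine (show ht C < k ∨ ht C = k by omega).imp_right fun h => ⟨h, ?_⟩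
        rw [hC]
        exact C.connected_toSimpleGraph
    exact ⟨e, fun v => (he v).elim fun i hi => hf1 i hi⟩
  by_cases hdc : d = c
  · subst hdc
    exact key k S hS (by omega)
  · have hd : d = !c := by cases c <;> cases d <;> simp_all
    subst hd
    rw [← hHK] at hk
    have hk' : h + 1 < k := hk.resolve_right fun h => hcon h.2
    obtain ⟨k, rfl⟩ := Nat.exists_eq_add_of_le' (show 1 ≤ k by omega)
    obtain ⟨f, hf1, hf2, hf3⟩ := hS
    have hpos : 0 < n := by
      obtain ⟨C, _⟩ := hmax
      obtain ⟨x, _⟩ := C.exists_rep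
      have : Nonempty α := ⟨x⟩
      exact Nat.card_pos.trans_le hn
    obtain ⟨e, he⟩ := key k (f ⟨0, hpos⟩) (by simpa using hf2 ⟨0, hpos⟩) (by omega)
    exact ⟨e, fun v => hf1 _ (he v)⟩

/-- A large tree of depth `k` contains all small cographs of height less than `k`, and those of
height `k` that are connected or anticonnected in accordance with the root of the tree. -/
theorem CographHeight.exists_embedding_of_has {n : ℕ} {V : Type} {G : SimpleGraph V} {α : Type}
    {H : SimpleGraph α} {h : ℕ} (hH : CographHeight H h) :
    ∀ [Finite α], Nat.card α ≤ n → ∀ (k : ℕ) (c : Bool) (S : Set V), Has G n c k S →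
      (h < k ∨ h = k ∧ (twist c H).Connected) → ∃ e : H ↪g G, ∀ v, e v ∈ S := by
  induction hH with
  | single H v hv =>
    intro _ hn k c S hS _
    have : Nonempty _ := ⟨v⟩
    obtain ⟨x, hx⟩ := hS.nonempty (Nat.card_pos.trans_le hn)
    refine ⟨⟨⟨fun _ => x, fun a b _ => (hv a).trans (hv b).symm⟩, fun {a b} => ?_⟩, fun _ => hx⟩
    rw [hv a, hv b]
    simp
  | union H h hcon ht hc hle hmax ih =>
    intro _ hn k c S hS hk
    exact exists_embedding_of_has_of_components (c := false) hn rfl hcon hle hmax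
      (fun C k d T hT hC => ih C ((Nat.card_le_card_of_injective _
        Subtype.val_injective).trans hn) k d T hT hC) hS hk
  | join H h hcon ht hc hle hmax ih =>
    intro _ hn k c S hS hk
    exact exists_embedding_of_has_of_components (c := true) hn rfl hcon hle hmax
      (fun C k d T hT hC => ih C ((Nat.card_le_card_of_injective _
        Subtype.val_injective).trans hn) k d T hT hC) hS hk

/-- The leaves of the complete `n`-ary tree of depth `k`. -/
abbrev Leaf (n : ℕ) : ℕ → Type
  | 0 => Unit
  | k + 1 => Fin n × Leaf n k

instance Leaf.fintype (n : ℕ) : ∀ k, Fintype (Leaf n k)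
  | 0 => inferInstanceAs (Fintype Unit)
  | k + 1 => letI := Leaf.fintype n k; inferInstanceAs (Fintype (Fin n × Leaf n k))

theorem Leaf.nonempty {n : ℕ} (hn : 0 < n) : ∀ k, Nonempty (Leaf n k)
  | 0 => ⟨()⟩
  | k + 1 => (Leaf.nonempty hn k).map fun x => (⟨0, hn⟩, x)

/-- The cograph whose cotree is the complete `n`-ary tree of depth `k`, the root being a join
(`c = true`) or a disjoint union (`c = false`). -/
def treeGraph (n : ℕ) : ∀ (_ : Bool) (k : ℕ), SimpleGraph (Leaf n k)
  | _, 0 => ⊥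
  | c, k + 1 => SimpleGraph.mk
      (fun p q : Fin n × Leaf n k =>
        (p.1 ≠ q.1 ∧ c = true) ∨ (p.1 = q.1 ∧ (treeGraph n (!c) k).Adj p.2 q.2))
      ⟨fun _ _ h => h.imp (fun h => ⟨h.1.symm, h.2⟩) fun h => ⟨h.1.symm, h.2.symm⟩⟩
      ⟨fun _ h => h.elim (fun h => h.1 rfl) fun h => (treeGraph n (!c) k).loopless.irrefl _ h.2⟩

theorem treeGraph_succ_adj {n k : ℕ} {c : Bool} {i j : Fin n} {x y : Leaf n k} :
    (treeGraph n c (k + 1)).Adj (i, x) (j, y) ↔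
      (i ≠ j ∧ c = true) ∨ (i = j ∧ (treeGraph n (!c) k).Adj x y) := Iff.rfl

theorem treeGraph_compl (n : ℕ) (c : Bool) (k : ℕ) :
    (treeGraph n c k)ᶜ = treeGraph n (!c) k := by
  induction k generalizing c with
  | zero =>
    ext x y
    have : x = y := Subsingleton.elim (α := Unit) x y
    simp [this]
  | succ k ih =>
    ext ⟨i, x⟩ ⟨j, y⟩
    rw [SimpleGraph.compl_adj, treeGraph_succ_adj, treeGraph_succ_adj, ← ih (!c),
      SimpleGraph.compl_adj]
    have hp : ((i, x) : Fin n × Leaf n k) = (j, y) ↔ i = j ∧ x = y := Prod.mk_inj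
    have hp' : @Eq (Leaf n (k + 1)) (i, x) (j, y) ↔ i = j ∧ x = y := hp
    rw [Ne, hp']
    cases c <;> by_cases h : i = j <;> simp [h]

theorem has_of_treeGraph_embedding {n k : ℕ} {c : Bool} {V : Type} {G : SimpleGraph V}
    (e : treeGraph n c k ↪g G) : Has G n c k (Set.range e) := by
  induction k generalizing c with
  | zero => exact ⟨e (), (), rfl⟩
  | succ k ih =>
    let E : Fin n → (treeGraph n (!c) k ↪g G) := fun i =>
      { toFun := fun x => e (i, x)
        inj' := fun x y h => (Prod.mk_inj.mp (e.injective h)).2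
        map_rel_iff' := fun {x y} => by
          change G.Adj (e (i, x)) (e (i, y)) ↔ _
          rw [SimpleGraph.Embedding.map_adj_iff, treeGraph_succ_adj]
          simp }
    refine ⟨fun i => Set.range (E i), fun i => ?_, fun i => ih (E i), ?_⟩
    · rintro _ ⟨x, rfl⟩
      exact ⟨(i, x), rfl⟩
    · rintro i j hij _ ⟨x, rfl⟩ _ ⟨y, rfl⟩
      refine ⟨fun h => hij (Prod.mk_inj.mp (e.injective h)).1, ?_⟩
      change G.Adj (e (i, x)) (e (j, y)) ↔ _
      rw [SimpleGraph.Embedding.map_adj_iff, treeGraph_succ_adj]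
      simp [hij]

theorem treeGraph_true_connected {n : ℕ} (hn : 2 ≤ n) (k : ℕ) :
    (treeGraph n true k).Connected := by
  have := Leaf.nonempty (show 0 < n by omega) k
  refine ⟨fun p q => ?_⟩
  cases k with
  | zero => rw [show p = q from Subsingleton.elim (α := Unit) p q]
  | succ k =>
    obtain ⟨i, x⟩ := p
    obtain ⟨j, y⟩ := q
    have : Nontrivial (Fin n) := Fin.nontrivial_iff_two_le.mpr hn
    by_cases hij : i = j
    · obtain ⟨l, hl⟩ := exists_ne i
      have h1 : (treeGraph n true (k + 1)).Adj (i, x) (l, x) :=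
        treeGraph_succ_adj.mpr (Or.inl ⟨hl.symm, rfl⟩)
      have h2 : (treeGraph n true (k + 1)).Adj (l, x) (j, y) :=
        treeGraph_succ_adj.mpr (Or.inl ⟨hij ▸ hl, rfl⟩)
      exact h1.reachable.trans h2.reachable
    · exact (treeGraph_succ_adj.mpr (Or.inl ⟨hij, rfl⟩)).reachable

/-- The subgraph of a tree graph induced by the leaves below a child of the root. -/
def treeGraphChildIso {n k : ℕ} {c : Bool} {W : Type} {Q : SimpleGraph W}
    (e : Q ≃g treeGraph n c (k + 1)) (i : Fin n) :
    Q.induce {w | (e w).1 = i} ≃g treeGraph n (!c) k where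
  toFun w := (e w.1).2
  invFun x := ⟨e.symm (i, x), congrArg Prod.fst (e.apply_symm_apply (i, x))⟩
  left_inv := by
    rintro ⟨w, rfl⟩
    exact Subtype.ext (e.symm_apply_apply w)
  right_inv x := congrArg Prod.snd (e.apply_symm_apply (i, x))
  map_rel_iff' := by
    rintro ⟨v, rfl⟩ ⟨w, hw⟩
    have hw' : (e w).1 = (e v).1 := hw
    have h : Q.Adj v w ↔ _ := (e.map_adj_iff).symm
    change (treeGraph n (!c) k).Adj (e v).2 (e w).2 ↔ Q.Adj v w
    rw [h, show e v = ((e v).1, (e v).2) from rfl, show e w = ((e w).1, (e w).2) from rfl,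
      treeGraph_succ_adj, hw']
    simp

theorem reachable_iff_of_treeGraph_false {n k : ℕ} (hn : 2 ≤ n) {W : Type} {K : SimpleGraph W}
    (e : K ≃g treeGraph n false (k + 1)) (v w : W) :
    K.Reachable v w ↔ (e v).1 = (e w).1 := by
  constructor
  · rintro ⟨p⟩
    induction p with
    | nil => rfl
    | @cons u v w h p ih =>
      have h' : (treeGraph n false (k + 1)).Adj ((e u).1, (e u).2) ((e v).1, (e v).2) :=
        e.map_adj_iff.mpr h
      rw [treeGraph_succ_adj] at h'
      exact (h'.resolve_left (by simp)).1.trans ih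
  · intro h
    have hc := (treeGraphChildIso e (e w).1).connected_iff.mpr (treeGraph_true_connected hn k)
    exact (hc.preconnected ⟨v, h⟩ ⟨w, rfl⟩).map (SimpleGraph.Embedding.induce _).toHom

theorem supp_eq_of_treeGraph_false {n k : ℕ} (hn : 2 ≤ n) {W : Type} {K : SimpleGraph W}
    (e : K ≃g treeGraph n false (k + 1)) (C : K.ConnectedComponent) :
    ∃ i, C.supp = {w | (e w).1 = i} := by
  obtain ⟨v, rfl⟩ := C.exists_rep
  refine ⟨(e v).1, Set.ext fun w => ?_⟩
  exact SimpleGraph.ConnectedComponent.eq.trans (reachable_iff_of_treeGraph_false hn e w v)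

theorem not_connected_of_treeGraph_false {n k : ℕ} (hn : 2 ≤ n) {W : Type} {K : SimpleGraph W}
    (e : K ≃g treeGraph n false (k + 1)) : ¬ K.Connected := by
  intro h
  obtain ⟨x⟩ := Leaf.nonempty (show 0 < n by omega) k
  have := (reachable_iff_of_treeGraph_false hn e (e.symm (⟨0, by omega⟩, x))
    (e.symm (⟨1, by omega⟩, x))).mp (h.preconnected _ _)
  rw [e.apply_symm_apply, e.apply_symm_apply] at this
  simp at this

theorem cographHeight_of_iso_treeGraph {n : ℕ} (hn : 2 ≤ n) {k : ℕ} :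
    ∀ {c : Bool} {W : Type} {Q : SimpleGraph W}, (Q ≃g treeGraph n c k) → CographHeight Q k := by
  induction k with
  | zero =>
    intro c W Q e
    exact .single Q (e.symm ()) fun w => e.injective (Subsingleton.elim (α := Unit) _ _)
  | succ k ih =>
    intro c W Q e
    obtain ⟨x⟩ := Leaf.nonempty (show 0 < n by omega) (k + 1)
    cases c with
    | false =>
      refine .union Q k (not_connected_of_treeGraph_false hn e) (fun _ => k) (fun C => ?_)
        (fun _ => le_rfl) ⟨Q.connectedComponentMk (e.symm x), rfl⟩
      obtain ⟨i, hi⟩ := supp_eq_of_treeGraph_false hn e C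
      rw [hi]
      exact ih (treeGraphChildIso e i)
    | true =>
      let e' : Qᶜ ≃g treeGraph n false (k + 1) :=
        { toEquiv := e.toEquiv
          map_rel_iff' := fun {a b} => by
            rw [← Bool.not_true, ← treeGraph_compl]
            exact and_congr e.injective.ne_iff (not_congr e.map_adj_iff) }
      refine .join Q k (not_connected_of_treeGraph_false hn e') (fun _ => k) (fun C => ?_)
        (fun _ => le_rfl) ⟨Qᶜ.connectedComponentMk (e.symm x), rfl⟩
      obtain ⟨i, hi⟩ := supp_eq_of_treeGraph_false hn e' C
      rw [hi]
      exact ih (treeGraphChildIso e i)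

theorem contains_of_embedding_s4 {α β : Type} {G : SimpleGraph α} {H : SimpleGraph β}
    (e : H ↪g G) : Contains G H :=
  ⟨Set.range e, ⟨SimpleGraph.Embedding.isoInduceRange e |>.symm⟩⟩

theorem free_induce_treeGraph {n L k : ℕ} (hL : L ≤ n) {c : Bool} {V : Type} {G : SimpleGraph V}
    {X : Set V} (h : ¬ Has G L c k X) : Free (G.induce X) (treeGraph n c k) := by
  rintro ⟨s, ⟨e⟩⟩
  let E : treeGraph n c k ↪g G := ((SimpleGraph.Embedding.induce X).comp
    (SimpleGraph.Embedding.induce s)).comp e.symm.toEmbedding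
  refine h ((has_of_treeGraph_embedding E).mono hL ?_)
  rintro _ ⟨x, rfl⟩
  exact (e.symm x).1.2

end Cographs

/-- Let `k ≥ 1` and let `H, J` be cographs of height `k+1` with `H` anticonnected and
`J` connected.  Then there exist cographs `H̃, J̃` of height `k`, with `H̃` connected and
`J̃` anticonnected, such that every `{H,J}`-free graph is `{H̃,J̃}`-split. -/
theorem stmt4 (k : ℕ) (hk : 1 ≤ k) {α β : Type} [Fintype α] [Fintype β]
    (H : SimpleGraph α) (J : SimpleGraph β)
    (hHheight : CographHeight H (k + 1)) (hJheight : CographHeight J (k + 1))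
    (hHanti : Hᶜ.Connected) (hJconn : J.Connected) :
    ∃ (γ δ : Type) (_ : Fintype γ) (_ : Fintype δ)
      (Ht : SimpleGraph γ) (Jt : SimpleGraph δ),
      CographHeight Ht k ∧ CographHeight Jt k ∧ Ht.Connected ∧ Jtᶜ.Connected ∧
      ∀ (ε : Type) [Fintype ε] (G : SimpleGraph ε), Free G H → Free G J →
        Split G Ht Jt := by
  let n := max (Nat.card α) (Nat.card β)
  obtain ⟨L, hL⟩ := exists_treeSplit n hk n n
  have h2 : 2 ≤ max 2 L := le_max_left _ _
  refine ⟨Leaf (max 2 L) k, Leaf (max 2 L) k, inferInstance, inferInstance,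
    treeGraph _ true k, treeGraph _ false k, cographHeight_of_iso_treeGraph h2 SimpleGraph.Iso.refl,
    cographHeight_of_iso_treeGraph h2 SimpleGraph.Iso.refl, treeGraph_true_connected h2 k, ?_,
    fun ε _ G hGH hGJ => ?_⟩
  · rw [treeGraph_compl]
    exact treeGraph_true_connected h2 k
  · obtain ⟨X, hX, hXL⟩ := hL ε G Set.univ
      (fun h => hGH <| by
        obtain ⟨e, _⟩ := hHheight.exists_embedding_of_has (n := n) (le_max_left _ _) (k + 1) false
          Set.univ h (Or.inr ⟨rfl, hHanti⟩)
        exact contains_of_embedding_s4 e)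
      (fun h => hGJ <| by
        obtain ⟨e, _⟩ := hJheight.exists_embedding_of_has (n := n) (le_max_right _ _) (k + 1) true
          Set.univ h (Or.inr ⟨rfl, hJconn⟩)
        exact contains_of_embedding_s4 e)
    exact ⟨X true, X false, Set.univ_subset_iff.mp hX,
      free_induce_treeGraph (le_max_right _ _) (hXL true),
      free_induce_treeGraph (le_max_right _ _) (hXL false)⟩
end

section
/- Let p > 0 be an integer. There exists an integer r > 0 such that for every graph G, if every induced subgraph of G with at most r vertices is {K_p, S_p}-split, then G is {K_p, S_p}-split, where K_p is the complete graph on p vertices and S_p is its complement (the edgeless graph on p vertices). -/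
namespace SimpleGraph

/-- Two-colour Ramsey theorem: a finite vertex set with no `m`-clique and no `n`-clique of the
complement has size bounded in terms of `m` and `n`. -/
theorem exists_card_lt_of_cliqueFreeOn_compl (m n : ℕ) :
    ∃ R : ℕ, ∀ (V : Type) (G : SimpleGraph V) (S : Finset V),
      G.CliqueFreeOn S m → Gᶜ.CliqueFreeOn S n → S.card < R := by
  classical
  induction m generalizing n with
  | zero => exact ⟨0, fun V G S h _ => (h (t := ∅) (by simp) (by simp)).elim⟩
  | succ m ihm =>
    induction n with
    | zero => exact ⟨0, fun V G S _ h => (h (t := ∅) (by simp) (by simp)).elim⟩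
    | succ n ihn =>
      obtain ⟨R₁, h₁⟩ := ihm (n + 1)
      obtain ⟨R₂, h₂⟩ := ihn
      refine ⟨R₁ + R₂ + 1, fun V G S hm hn => ?_⟩
      obtain rfl | ⟨v, hv⟩ := S.eq_empty_or_nonempty
      · simp
      have hN := h₁ V G {w ∈ S | G.Adj v w} ((hm.of_succ _ hv).subset _ fun w => by simp)
        (hn.subset _ fun w => by simp +contextual)
      have hN' := h₂ V G {w ∈ S | Gᶜ.Adj v w} (hm.subset _ fun w => by simp +contextual)
        ((hn.of_succ _ hv).subset _ fun w => by simp +contextual)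
      have hS : S ⊆ {v} ∪ ({w ∈ S | G.Adj v w} ∪ {w ∈ S | Gᶜ.Adj v w}) := fun w hw => by
        simp only [Finset.mem_union, Finset.mem_singleton, Finset.mem_filter, compl_adj]
        tauto
      have := Finset.card_le_card hS
      have := Finset.card_union_le {v} ({w ∈ S | G.Adj v w} ∪ {w ∈ S | Gᶜ.Adj v w})
      have := Finset.card_union_le {w ∈ S | G.Adj v w} {w ∈ S | Gᶜ.Adj v w}
      have := Finset.card_singleton v
      omega

variable {V : Type}

theorem compl_induce (G : SimpleGraph V) (s : Set V) : (G.induce s)ᶜ = Gᶜ.induce s := by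
  ext a b
  simp [Subtype.ext_iff]

theorem CliqueFreeOn.insert {G : SimpleGraph V} {s : Set V} {n : ℕ}
    (h : G.CliqueFreeOn s n) (v : V) : G.CliqueFreeOn (insert v s) (n + 1) := by
  classical
  intro t hts ht
  by_cases hv : v ∈ t
  · refine h (t := t.erase v) (fun w hw => ?_) (ht.erase_of_mem hv)
    simp only [Finset.coe_erase, Set.mem_sdiff, Set.mem_singleton_iff] at hw
    exact (hts hw.1).resolve_left hw.2
  · refine h.mono _ n.le_succ (fun w hw => (hts hw).resolve_left ?_) ht
    rintro rfl
    exact hv hw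

/-- `X` and its complement cut `S` into a part with no `p`-clique and a part with no
`p`-clique of the complement. -/
def IsSplitOn (G : SimpleGraph V) (p : ℕ) (S X : Set V) : Prop :=
  G.CliqueFreeOn (S ∩ X) p ∧ Gᶜ.CliqueFreeOn (S \ X) p

/-- Moving to any split from a partition `A` that violates the splitting property involves
changing the side of some vertex of a set of size `p`. -/
theorem exists_mem_symmDiff_of_not_isSplitOn [DecidableEq V] {G : SimpleGraph V} {p : ℕ}
    {S A : Finset V} (h : ¬ G.IsSplitOn p S A) :
    ∃ Q ⊆ S, Q.card = p ∧ ∀ W X : Finset V, Q ⊆ W → G.IsSplitOn p W X →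
      ∃ q ∈ Q, q ∈ symmDiff X A := by
  simp only [IsSplitOn, CliqueFreeOn, not_and_or, not_forall, not_not] at h
  obtain ⟨Q, hQ, hc⟩ | ⟨Q, hQ, hc⟩ := h
  · refine ⟨Q, fun q hq => (hQ hq).1, hc.card_eq, fun W X hW hX => ?_⟩
    by_contra! hne
    refine hX.1 (fun q hq => ⟨hW hq, ?_⟩) hc
    have := hne q hq
    have := (hQ hq).2
    simp only [Finset.mem_symmDiff, Finset.mem_coe] at *
    tauto
  · refine ⟨Q, fun q hq => (hQ hq).1, hc.card_eq, fun W X hW hX => ?_⟩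
    by_contra! hne
    refine hX.2 (fun q hq => ⟨hW hq, ?_⟩) hc
    have := hne q hq
    have := (hQ hq).2
    simp only [Finset.mem_symmDiff, Finset.mem_coe] at *
    tauto

/-- If `S` has no split, then for each `k` a bounded subset `W` of `S` already forces every split
of `W` to differ from a given partition `A` in more than `k` vertices. -/
theorem exists_bounded_forcing_subset (p k : ℕ) :
    ∃ r : ℕ, ∀ (V : Type) [DecidableEq V] (G : SimpleGraph V) (S : Finset V),
      (∀ X : Finset V, ¬ G.IsSplitOn p S X) → ∀ A : Finset V, ∃ W ⊆ S, W.card ≤ r ∧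
        ∀ X : Finset V, G.IsSplitOn p W X → k < (symmDiff X A ∩ W).card := by
  induction k with
  | zero =>
    refine ⟨p, fun V _ G S hS A => ?_⟩
    obtain ⟨Q, hQS, hQ, hX⟩ := exists_mem_symmDiff_of_not_isSplitOn (hS A)
    refine ⟨Q, hQS, hQ.le, fun X h => ?_⟩
    obtain ⟨q, hq, hqX⟩ := hX Q X subset_rfl h
    exact Finset.card_pos.2 ⟨q, Finset.mem_inter.2 ⟨hqX, hq⟩⟩
  | succ k ih =>
    obtain ⟨r, hr⟩ := ih
    refine ⟨p + p * r, fun V _ G S hS A => ?_⟩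
    obtain ⟨Q, hQS, hQ, hX⟩ := exists_mem_symmDiff_of_not_isSplitOn (hS A)
    choose W hWS hWr hW using fun q => hr V G S hS (symmDiff A {q})
    refine ⟨Q ∪ Q.biUnion W, Finset.union_subset hQS (Finset.biUnion_subset.2 fun q _ => hWS q),
      ?_, fun X h => ?_⟩
    · refine (Finset.card_union_le _ _).trans ?_
      have := Finset.card_biUnion_le_card_mul Q W r fun q _ => hWr q
      rw [hQ] at *
      omega
    · obtain ⟨q, hq, hqX⟩ := hX _ X Finset.subset_union_left h
      have hWsub : W q ⊆ Q ∪ Q.biUnion W :=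
        (Finset.subset_biUnion_of_mem W hq).trans Finset.subset_union_right
      have hlt := hW q X ⟨h.1.subset _ (Set.inter_subset_inter_left _ (by exact_mod_cast hWsub)),
        h.2.subset _ (Set.sdiff_subset_sdiff_left (by exact_mod_cast hWsub))⟩
      have hsub : symmDiff X (symmDiff A {q}) ∩ W q ⊆
          (symmDiff X A ∩ (Q ∪ Q.biUnion W)).erase q := fun w hw => by
        rw [Finset.mem_inter, ← symmDiff_assoc, Finset.mem_symmDiff, Finset.mem_singleton] at hw
        rw [Finset.mem_erase, Finset.mem_inter]
        obtain ⟨⟨hw₁, hw₂⟩ | ⟨rfl, hw₂⟩, hw₃⟩ := hw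
        · exact ⟨hw₂, hw₁, hWsub hw₃⟩
        · exact (hw₂ hqX).elim
      have hle := Finset.card_le_card hsub
      have := Finset.card_erase_add_one
        (Finset.mem_inter.2 ⟨hqX, Finset.mem_union_left (Q.biUnion W) hq⟩)
      omega

/-- Having a split is determined by the subsets of bounded size. -/
theorem exists_isSplitOn_of_bounded_subsets (p : ℕ) :
    ∃ r : ℕ, ∀ (V : Type) (G : SimpleGraph V),
      (∀ W : Finset V, W.card ≤ r → ∃ X : Finset V, G.IsSplitOn p W X) →
        ∀ S : Finset V, ∃ X : Finset V, G.IsSplitOn p S X := by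
  classical
  obtain ⟨R, hR⟩ := exists_card_lt_of_cliqueFreeOn_compl (p + 1) (p + 1)
  obtain ⟨r, hr⟩ := exists_bounded_forcing_subset p (R + R)
  refine ⟨r, fun V G hG S => ?_⟩
  induction S using Finset.induction_on with
  | empty => exact hG ∅ (by simp)
  | insert v S _ ih =>
    by_contra! hS
    obtain ⟨A, hA⟩ := ih
    obtain ⟨W, hWS, hWr, hW⟩ := hr V G _ hS (insert v A)
    obtain ⟨X, hX⟩ := hG W hWr
    have hlt := hW X hX
    have h₁ := hR V G ((W ∩ X) \ (insert v A))
      (hX.1.subset _ (fun w => by simp +contextual) |>.mono _ p.le_succ)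
      (hA.2.mono _ p.le_succ |>.subset _ fun w hw => by
        have := @hWS w
        simp_all)
    have h₂ := hR V G ((W ∩ insert v A) \ X)
      ((hA.1.insert v).subset _ fun w hw => by
        have := @hWS w
        simp only [Finset.coe_sdiff, Finset.coe_inter, Set.mem_sdiff, Set.mem_inter_iff,
          Finset.mem_coe, Finset.mem_insert, Set.mem_insert_iff] at *
        tauto)
      (hX.2.subset _ (fun w => by simp +contextual) |>.mono _ p.le_succ)
    have hsub : symmDiff X (insert v A) ∩ W ⊆
        ((W ∩ X) \ (insert v A)) ∪ ((W ∩ insert v A) \ X) := fun w hw => by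
      simp only [Finset.mem_inter, Finset.mem_union, Finset.mem_sdiff, Finset.mem_symmDiff] at *
      tauto
    have := (Finset.card_le_card hsub).trans (Finset.card_union_le _ _)
    omega

end SimpleGraph

theorem contains_iff {α β : Type} {G : SimpleGraph α} {H : SimpleGraph β} :
    Contains G H ↔ Nonempty (H ↪g G) := by
  constructor
  · rintro ⟨s, ⟨e⟩⟩
    exact ⟨(SimpleGraph.Embedding.induce s).comp e.symm.toEmbedding⟩
  · rintro ⟨f⟩
    refine ⟨Set.range f, ⟨RelIso.symm ⟨Equiv.ofInjective f f.injective, ?_⟩⟩⟩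
    intro a b
    exact f.map_adj_iff

theorem free_top_iff {α : Type} {G : SimpleGraph α} {p : ℕ} :
    Free G (⊤ : SimpleGraph (Fin p)) ↔ G.CliqueFree p := by
  rw [Free, contains_iff, ← not_iff_not, not_not, SimpleGraph.not_cliqueFree_iff_top_isContained]
  exact ⟨fun ⟨f⟩ => ⟨f.toCopy⟩, fun ⟨f⟩ => ⟨⟨⟨f, f.injective⟩, fun {a b} =>
    ⟨fun h => by rintro rfl; exact h.ne rfl, fun h => f.toHom.map_adj h⟩⟩⟩⟩

theorem free_bot_iff {α : Type} {G : SimpleGraph α} {p : ℕ} :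
    Free G (⊥ : SimpleGraph (Fin p)) ↔ Gᶜ.CliqueFree p := by
  rw [← free_top_iff, Free, Free, contains_iff, contains_iff, not_iff_not, ← compl_bot]
  exact ⟨fun ⟨f⟩ => ⟨SimpleGraph.Embedding.complEquiv f⟩,
    fun ⟨f⟩ => ⟨SimpleGraph.Embedding.complEquiv.symm f⟩⟩

theorem free_induce_top_iff {α : Type} {G : SimpleGraph α} {p : ℕ} {X : Set α} :
    Free (G.induce X) (⊤ : SimpleGraph (Fin p)) ↔ G.CliqueFreeOn X p := by
  rw [free_top_iff, SimpleGraph.cliqueFree_induce_iff]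

theorem free_induce_bot_iff {α : Type} {G : SimpleGraph α} {p : ℕ} {X : Set α} :
    Free (G.induce X) (⊥ : SimpleGraph (Fin p)) ↔ Gᶜ.CliqueFreeOn X p := by
  rw [free_bot_iff, SimpleGraph.compl_induce, SimpleGraph.cliqueFree_induce_iff]

theorem split_iff {α : Type} {G : SimpleGraph α} {p : ℕ} :
    Split G (⊤ : SimpleGraph (Fin p)) (⊥ : SimpleGraph (Fin p)) ↔
      ∃ X, G.IsSplitOn p Set.univ X := by
  simp only [Split, free_induce_top_iff, free_induce_bot_iff, SimpleGraph.IsSplitOn, Set.univ_inter]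
  refine ⟨fun ⟨X₁, X₂, h, h₁, h₂⟩ => ⟨X₁, h₁, h₂.subset _ fun w hw => ?_⟩,
    fun ⟨X, h₁, h₂⟩ => ⟨X, Set.univ \ X, by simp, h₁, h₂⟩⟩
  exact (h.symm.subset hw.1).resolve_left hw.2

theorem cliqueFreeOn_of_induce {α : Type} {G : SimpleGraph α} {p : ℕ} {S : Set α} {X : Set S}
    (h : (G.induce S).CliqueFreeOn X p) : G.CliqueFreeOn (Subtype.val '' X) p := by
  classical
  intro t ht hc
  have htS : ∀ v ∈ t, v ∈ S := fun v hv => by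
    obtain ⟨x, -, rfl⟩ := ht hv
    exact x.2
  refine h (t := t.subtype (· ∈ S)) (fun x hx => ?_) ?_
  · obtain ⟨y, hy, hyx⟩ := ht (Finset.mem_subtype.1 hx)
    rwa [← Subtype.ext hyx]
  · rwa [SimpleGraph.isNClique_induce_iff, Finset.subtype_map, Finset.filter_true_of_mem htS]

theorem exists_isSplitOn_of_split_induce {α : Type} {G : SimpleGraph α} {p : ℕ} {S : Set α}
    (h : Split (G.induce S) (⊤ : SimpleGraph (Fin p)) (⊥ : SimpleGraph (Fin p))) :
    ∃ X, G.IsSplitOn p S X := by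
  obtain ⟨X, h₁, h₂⟩ := split_iff.1 h
  rw [SimpleGraph.compl_induce] at h₂
  refine ⟨Subtype.val '' X, (cliqueFreeOn_of_induce h₁).subset _ ?_,
    (cliqueFreeOn_of_induce h₂).subset _ ?_⟩
  · rintro _ ⟨-, x, hx, rfl⟩
    exact ⟨x, ⟨trivial, hx⟩, rfl⟩
  · rintro w ⟨hw, hwX⟩
    exact ⟨⟨w, hw⟩, ⟨trivial, fun hx => hwX ⟨_, hx, rfl⟩⟩, rfl⟩

/-- For every integer `p > 0` there exists `r > 0` such that for every graph `G`,
if every induced subgraph of `G` with at most `r` vertices is `{K_p,S_p}`-split,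
then `G` is `{K_p,S_p}`-split. -/
theorem stmt5 (p : ℕ) (hp : 0 < p) :
    ∃ r : ℕ, 0 < r ∧
      ∀ (γ : Type) [Fintype γ] (G : SimpleGraph γ),
        (∀ S : Set γ, S.ncard ≤ r →
          Split (G.induce S) (⊤ : SimpleGraph (Fin p)) (⊥ : SimpleGraph (Fin p))) →
        Split G (⊤ : SimpleGraph (Fin p)) (⊥ : SimpleGraph (Fin p)) := by
  classical
  obtain ⟨r, hr⟩ := SimpleGraph.exists_isSplitOn_of_bounded_subsets p
  refine ⟨r + 1, r.succ_pos, fun γ _ G hG => split_iff.2 ?_⟩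
  have hsmall : ∀ W : Finset γ, W.card ≤ r → ∃ X : Finset γ, G.IsSplitOn p W X := fun W hW => by
    obtain ⟨X, hX⟩ := exists_isSplitOn_of_split_induce
      (hG W (by rw [Set.ncard_coe_finset]; omega))
    exact ⟨X.toFinset, by simpa using hX⟩
  obtain ⟨X, hX⟩ := hr γ G hsmall Finset.univ
  exact ⟨X, by simpa using hX⟩
end
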